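/- arXiv:2505.00493 — 6 statements merged into one kernel-verified Lean document; each statement's English description precedes it below -/
import Mathlib

section
/- (Parametrisation for cubic discriminants) Let a, h, y, d be positive integers with y ∣ h, gcd(a,h) = 1, gcd(h, y²) squarefree, and gcd(y, ad) = 1. Let H_y := {(e f; 0 g) : e, g ≥ 1, eg = y, 0 ≤ f < g} (Hecke orbit representatives of determinant y). Then S_{a, h y²}(d) is the disjoint union over σ ∈ H_y of the sets {(yσ⁻¹) 𝔤 (yσ⁻¹)ᵗ : 𝔤 ∈ S_{a,h}(d)}; equivalently, every 𝔤' ∈ S_{a, h y²}(d) has a unique representation 𝔤' = (yσ⁻¹) ⋄ 𝔤 with σ ∈ H_y and 𝔤 ∈ S_{a,h}(d). (Note that for σ = (e f; 0 g) ∈ H_y one has yσ⁻¹ = (g −f; 0 e), an integer matrix of determinant y.) -/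
open Matrix

/-- The set `S_{a,h}(d)` of symmetric 2×2 integer matrices `(𝔞 𝔟; 𝔟 𝔠)` with
`𝔞𝔠 − 𝔟² = ah`, `𝔞 > 0`, `𝔠 > 0`, `ad ∣ 𝔠` and `a ∣ 𝔟`. -/
def Sah (a h d : ℕ) : Set (Matrix (Fin 2) (Fin 2) ℤ) :=
  {g | g 0 1 = g 1 0 ∧ g 0 0 * g 1 1 - (g 0 1) ^ 2 = (a : ℤ) * (h : ℤ) ∧
    0 < g 0 0 ∧ 0 < g 1 1 ∧ ((a : ℤ) * (d : ℤ)) ∣ g 1 1 ∧ (a : ℤ) ∣ g 0 1}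

/-- For `σ = (e f; 0 g) ∈ H_y` the integer matrix `yσ⁻¹ = (g −f; 0 e)`. -/
def yInv (e f g : ℤ) : Matrix (Fin 2) (Fin 2) ℤ := !![g, -f; 0, e]

/-- A squarefree integer divides every integer divisible by all its prime factors. -/
theorem dvd_of_squarefree_of_prime_dvd {n x : ℤ} (hn : Squarefree n)
    (H : ∀ p : ℤ, Prime p → p ∣ n → p ∣ x) : n ∣ x := by
  obtain ⟨m, hm⟩ := Int.gcd_dvd_left n x
  by_cases hu : IsUnit m
  · have h : n ∣ (Int.gcd n x : ℤ) := by
      obtain ⟨u, rfl⟩ := hu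
      exact ⟨((u⁻¹ : ℤˣ) : ℤ), by
        conv_rhs => rw [hm]
        rw [mul_assoc, Units.mul_inv, mul_one]⟩
    exact h.trans (Int.gcd_dvd_right n x)
  · exfalso
    have hm0 : m ≠ 0 := by
      rintro rfl
      exact hn.ne_zero (by simpa using hm)
    obtain ⟨p, hp, hpm⟩ := WfDvdMonoid.exists_irreducible_factor hu hm0
    have hpn : p ∣ n := hpm.trans ⟨_, hm.trans (mul_comm _ _)⟩
    have hpx := H p hp.prime hpn
    have hpg : p ∣ (Int.gcd n x : ℤ) := Int.dvd_coe_gcd hpn hpx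
    exact hp.not_isUnit (hn p (by rw [hm]; exact mul_dvd_mul hpg hpm))

theorem conj_yInv (e f g : ℤ) (G : Matrix (Fin 2) (Fin 2) ℤ) :
    yInv e f g * G * (yInv e f g)ᵀ =
      !![g ^ 2 * G 0 0 - f * g * (G 0 1 + G 1 0) + f ^ 2 * G 1 1, e * (g * G 0 1 - f * G 1 1);
        e * (g * G 1 0 - f * G 1 1), e ^ 2 * G 1 1] := by
  ext i j
  fin_cases i <;> fin_cases j <;>
    simp [yInv, Matrix.mul_apply, Matrix.vecMul, dotProduct, Fin.sum_univ_two] <;> ring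

theorem pos_of_mul_sub_sq_pos {A B C D : ℤ} (hC : 0 < C) (hD : 0 < D)
    (h : A * C - B ^ 2 = D) : 0 < A := by
  have : 0 < A * C := by nlinarith [sq_nonneg B]
  exact pos_of_mul_pos_left this hC.le

/-- For a form of determinant `D`, a prime dividing `D` whose square does not divide `D` cannot have its
square divide the last coefficient. -/
theorem not_sq_dvd_of_det {A B C D p : ℤ} (hp : Prime p) (hD : p ∣ D) (hD2 : ¬ p ^ 2 ∣ D)
    (h : A * C - B ^ 2 = D) : ¬ p ^ 2 ∣ C := by
  intro hC
  have hB : p ∣ B := by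
    apply hp.dvd_of_dvd_pow (n := 2)
    have : B ^ 2 = A * C - D := by linarith
    rw [this]
    exact dvd_sub (((dvd_pow_self p two_ne_zero).trans hC).mul_left _) hD
  exact hD2 (h ▸ dvd_sub (hC.mul_left _) (pow_dvd_pow_of_dvd hB 2))

/-- Uniqueness of the divisor `e` (one divisibility). -/
theorem dvd_of_sq_mul_eq {A₂ B₂ C₁ C₂ D y e₁ e₂ g₁ : ℤ} (hy : Squarefree y)
    (hD : ∀ p, Prime p → p ∣ y → p ∣ D ∧ ¬ p ^ 2 ∣ D)
    (h₁ : e₁ * g₁ = y) (hdet : A₂ * C₂ - B₂ ^ 2 = D)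
    (hC : e₁ ^ 2 * C₁ = e₂ ^ 2 * C₂) : e₁ ∣ e₂ := by
  refine dvd_of_squarefree_of_prime_dvd (hy.squarefree_of_dvd ⟨g₁, h₁.symm⟩) fun p hp hpe => ?_
  by_contra hpe₂
  have hpy : p ∣ y := h₁ ▸ hpe.mul_right _
  obtain ⟨hpD, hpD2⟩ := hD p hp hpy
  refine not_sq_dvd_of_det hp hpD hpD2 hdet ?_
  have hco : IsCoprime (p ^ 2) (e₂ ^ 2) := ((hp.coprime_iff_not_dvd).2 hpe₂).pow
  exact hco.dvd_of_dvd_mul_left (hC ▸ (pow_dvd_pow_of_dvd hpe 2).mul_right _)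

/-- The shift `f` is determined modulo `g`. -/
theorem dvd_sub_of_shift_eq {A₁ B₁ A₂ B₂ C D g f₁ f₂ : ℤ} (hg : Squarefree g)
    (hD : ∀ p, Prime p → p ∣ g → p ∣ D ∧ ¬ p ^ 2 ∣ D)
    (h₁ : A₁ * C - B₁ ^ 2 = D) (h₂ : A₂ * C - B₂ ^ 2 = D)
    (h : g * B₁ - f₁ * C = g * B₂ - f₂ * C) : g ∣ f₁ - f₂ := by
  refine dvd_of_squarefree_of_prime_dvd hg fun p hp hpg => ?_
  obtain ⟨hpD, hpD2⟩ := hD p hp hpg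
  have hC2 := not_sq_dvd_of_det hp hpD hpD2 h₁
  have key : (f₁ - f₂) * C = g * (B₁ - B₂) := by linarith
  by_cases hpC : p ∣ C
  · have hB : ∀ A B : ℤ, A * C - B ^ 2 = D → p ∣ B := fun A B hAB => by
      apply hp.dvd_of_dvd_pow (n := 2)
      have : B ^ 2 = A * C - D := by linarith
      rw [this]
      exact dvd_sub (hpC.mul_left _) hpD
    have hd : p * p ∣ (f₁ - f₂) * C :=
      key ▸ mul_dvd_mul hpg (dvd_sub (hB _ _ h₁) (hB _ _ h₂))
    obtain ⟨c, rfl⟩ := hpC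
    have hc : ¬ p ∣ c := fun hc => hC2 (by rw [pow_two]; exact mul_dvd_mul_left p hc)
    have : p * p ∣ p * ((f₁ - f₂) * c) := by convert hd using 1; ring
    exact (hp.dvd_or_dvd ((mul_dvd_mul_iff_left hp.ne_zero).1 this)).resolve_right hc
  · exact (hp.dvd_or_dvd (key ▸ hpg.mul_right _ : p ∣ (f₁ - f₂) * C)).resolve_right hpC

theorem exists_dvd_sq_dvd_max {y C : ℤ} (hy : 0 < y) (hsq : Squarefree y) :
    ∃ e g : ℤ, 1 ≤ e ∧ 1 ≤ g ∧ e * g = y ∧ e ^ 2 ∣ C ∧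
      ∀ p, Prime p → p ∣ g → ¬ p ^ 2 ∣ C := by
  let s : Finset ℤ := (Finset.Icc 1 y).filter fun e => e ∣ y ∧ e ^ 2 ∣ C
  have hs : s.Nonempty := ⟨1, by simp [s]; omega⟩
  obtain ⟨e, he, hmax⟩ := s.exists_max_image id hs
  simp only [s, Finset.mem_filter, Finset.mem_Icc] at he
  obtain ⟨⟨he1, -⟩, ⟨g, hg⟩, heC⟩ := he
  have hg1 : 1 ≤ g := by
    have : 0 < e * g := hg ▸ hy
    exact pos_of_mul_pos_right this (by omega)
  refine ⟨e, g, he1, hg1, hg.symm, heC, fun p hp hpg hpC => ?_⟩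
  have hpe : ¬ p ∣ e := fun h => hp.not_isUnit (hsq p (hg ▸ mul_dvd_mul h hpg))
  have hco : IsCoprime (p ^ 2) (e ^ 2) := ((hp.coprime_iff_not_dvd).2 hpe).pow
  have habs : 2 ≤ |p| := by
    have h0 : |p| ≠ 0 := abs_ne_zero.2 hp.ne_zero
    have h1 : |p| ≠ 1 := fun h => hp.not_isUnit (Int.isUnit_iff_abs_eq.2 h)
    have := abs_nonneg p
    omega
  have hd : |p| * e ∣ y := by
    rw [hg, mul_comm]
    exact mul_dvd_mul_left e ((abs_dvd _ _).2 hpg)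
  have hm : |p| * e ∈ s := by
    simp only [s, Finset.mem_filter, Finset.mem_Icc]
    refine ⟨⟨by nlinarith, Int.le_of_dvd hy hd⟩, hd, ?_⟩
    rw [mul_pow, sq_abs]
    exact hco.mul_dvd hpC heC
  have := hmax _ hm
  simp only [id] at this
  nlinarith

/-- Existence of the shift `f`. -/
theorem exists_shift {A b C D g : ℤ} (hg0 : 0 < g) (hg : Squarefree g) (hgD : g ∣ D)
    (hC : ∀ p, Prime p → p ∣ g → ¬ p ^ 2 ∣ C) (h : A * C - b ^ 2 = D * g ^ 2) :
    ∃ f, 0 ≤ f ∧ f < g ∧ g ∣ b + f * C ∧ g ^ 2 ∣ A + 2 * f * b + f ^ 2 * C := by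
  obtain ⟨c, hc⟩ : ∃ c : ℤ, c = Int.gcd C g := ⟨_, rfl⟩
  have hcC : c ∣ C := hc ▸ Int.gcd_dvd_left C g
  have hcg : c ∣ g := hc ▸ Int.gcd_dvd_right C g
  have hcs : Squarefree c := hg.squarefree_of_dvd hcg
  have hc0 : c ≠ 0 := hcs.ne_zero
  have hcb : c ∣ b := by
    refine (hcs.dvd_pow_iff_dvd two_ne_zero).1 (?_ : c ∣ b ^ 2)
    have : b ^ 2 = A * C - D * g ^ 2 := by linarith
    rw [this]
    exact dvd_sub (hcC.mul_left _) ((hcg.trans hgD).mul_right _)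
  obtain ⟨C₀, hC₀⟩ := hcC
  have hco : IsCoprime C₀ g := by
    refine isCoprime_of_prime_dvd (fun h => hg0.ne' h.2) fun p hp hpC₀ hpg => ?_
    have hpc : p ∣ c := hc ▸ Int.dvd_coe_gcd (hC₀ ▸ hpC₀.mul_left _) hpg
    exact hC p hp hpg (by rw [hC₀, pow_two]; exact mul_dvd_mul hpc hpC₀)
  obtain ⟨b₀, rfl⟩ := hcb
  have hco2 : IsCoprime C₀ (g ^ 2) := hco.pow_right
  obtain ⟨u, v, huv⟩ := id hco2
  obtain ⟨F, hF⟩ : ∃ F, F = -b₀ * u := ⟨_, rfl⟩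
  have hX : g ^ 2 ∣ c * b₀ + F * C := ⟨c * b₀ * v, by
    rw [hF, hC₀]; linear_combination (-c * b₀) * huv⟩
  have hY : g ^ 2 ∣ A + 2 * F * (c * b₀) + F ^ 2 * C := by
    have hd : c * g ^ 2 ∣ c * (C₀ * (A + 2 * F * (c * b₀) + F ^ 2 * C)) := by
      have e1 : c * (C₀ * (A + 2 * F * (c * b₀) + F ^ 2 * C)) =
          (c * b₀ + F * C) ^ 2 + D * g ^ 2 := by
        rw [← h]
        rw [hC₀]; ring
      rw [e1]
      refine dvd_add ?_ (mul_dvd_mul_right (hcg.trans hgD) _)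
      rw [pow_two (c * b₀ + F * C)]
      exact mul_dvd_mul ((hcg.trans (dvd_pow_self g two_ne_zero)).trans hX) hX
    exact hco2.symm.dvd_of_dvd_mul_left ((mul_dvd_mul_iff_left hc0).1 hd)
  refine ⟨F % g, Int.emod_nonneg _ hg0.ne', Int.emod_lt_of_pos _ hg0, ?_, ?_⟩
  · obtain ⟨x, hx⟩ := hX
    refine ⟨g * x - F / g * C, ?_⟩
    rw [Int.emod_def]
    linear_combination hx
  · obtain ⟨x, hx⟩ := hX
    obtain ⟨z, hz⟩ := hY
    refine ⟨z - 2 * (F / g) * (g * x) + (F / g) ^ 2 * C, ?_⟩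
    rw [Int.emod_def]
    linear_combination hz - 2 * g * (F / g) * hx


/-- **Parametrisation for cubic discriminants.** Let `y ∣ h`, `gcd(a,h) = 1`,
`gcd(h,y²)` squarefree, `gcd(y, ad) = 1`. Then every element of `S_{a,hy²}(d)` is
`(yσ⁻¹) ⋄ 𝔤` for a unique `σ = (e f; 0 g) ∈ H_y` (so `eg = y`, `0 ≤ f < g`) and a unique
`𝔤 ∈ S_{a,h}(d)`; conversely each `(yσ⁻¹) ⋄ 𝔤` lies in `S_{a,hy²}(d)`. -/
theorem stmt8 (a h y d : ℕ) (ha : 0 < a) (hh : 0 < h) (hy : 0 < y) (hd : 0 < d)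
    (hyh : y ∣ h) (hah : Nat.Coprime a h) (hsq : Squarefree (Nat.gcd h (y ^ 2)))
    (hyad : Nat.Coprime y (a * d)) :
    (∀ e f g : ℤ, 1 ≤ e → 1 ≤ g → e * g = (y : ℤ) → 0 ≤ f → f < g →
        ∀ G ∈ Sah a h d, yInv e f g * G * (yInv e f g)ᵀ ∈ Sah a (h * y ^ 2) d) ∧
    (∀ G' ∈ Sah a (h * y ^ 2) d,
        ∃! q : (ℤ × ℤ × ℤ) × Matrix (Fin 2) (Fin 2) ℤ,
          1 ≤ q.1.1 ∧ 1 ≤ q.1.2.2 ∧ q.1.1 * q.1.2.2 = (y : ℤ) ∧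
          0 ≤ q.1.2.1 ∧ q.1.2.1 < q.1.2.2 ∧ q.2 ∈ Sah a h d ∧
          G' = yInv q.1.1 q.1.2.1 q.1.2.2 * q.2 * (yInv q.1.1 q.1.2.1 q.1.2.2)ᵀ) := by
  have hyZ : (0 : ℤ) < y := by exact_mod_cast hy
  have haZ : (0 : ℤ) < a := by exact_mod_cast ha
  have hhZ : (0 : ℤ) < h := by exact_mod_cast hh
  have hysq : Squarefree (y : ℤ) := Int.squarefree_natCast.2
    (hsq.squarefree_of_dvd (Nat.dvd_gcd hyh (dvd_pow_self y two_ne_zero)))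
  have hcoad : IsCoprime (y : ℤ) ((a : ℤ) * d) := by
    exact_mod_cast Nat.isCoprime_iff_coprime.2 hyad
  have hcoa : IsCoprime (y : ℤ) (a : ℤ) := hcoad.of_mul_right_left
  have hyhZ : (y : ℤ) ∣ h := by exact_mod_cast hyh
  have hD : ∀ p : ℤ, Prime p → p ∣ y → p ∣ (a : ℤ) * h ∧ ¬ p ^ 2 ∣ (a : ℤ) * h := by
    refine fun p hp hpy => ⟨(hpy.trans hyhZ).mul_left _, fun hpd => ?_⟩
    have hpa : IsCoprime (p ^ 2) (a : ℤ) := (hcoa.of_isCoprime_of_dvd_left hpy).pow_left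
    have hgs : Squarefree ((Nat.gcd h (y ^ 2) : ℕ) : ℤ) := Int.squarefree_natCast.2 hsq
    refine hp.not_isUnit (hgs p ?_)
    rw [← pow_two, ← Int.gcd_natCast_natCast]
    refine Int.dvd_coe_gcd (hpa.dvd_of_dvd_mul_left hpd) ?_
    push_cast
    exact pow_dvd_pow_of_dvd hpy 2
  constructor
  · rintro e f g he hg heg - - G ⟨hs, hdet, hA, hC, hdC, haB⟩
    rw [conj_yInv]
    have hdet' : (g ^ 2 * G 0 0 - f * g * (G 0 1 + G 1 0) + f ^ 2 * G 1 1) * (e ^ 2 * G 1 1)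
        - (e * (g * G 0 1 - f * G 1 1)) ^ 2 = (a : ℤ) * ((h * y ^ 2 : ℕ) : ℤ) := by
      push_cast
      rw [← hs, ← heg]
      linear_combination (e * g) ^ 2 * hdet
    have hC' : 0 < e ^ 2 * G 1 1 := by positivity
    refine ⟨?_, hdet', pos_of_mul_sub_sq_pos hC' (by positivity) hdet', hC',
      hdC.mul_left _, ?_⟩
    · simp [hs]
    · exact (dvd_sub (haB.mul_left _) (((dvd_mul_right _ _).trans hdC).mul_left _)).mul_left _
  · rintro G' ⟨hs, hdet, hA, hC, hdC, haB⟩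
    push_cast at hdet
    obtain ⟨e, g, he, hg, heg, ⟨C, hCe⟩, hmax⟩ := exists_dvd_sq_dvd_max (C := G' 1 1) hyZ hysq
    have hey : e ∣ (y : ℤ) := ⟨g, heg.symm⟩
    have hgy : g ∣ (y : ℤ) := ⟨e, by rw [← heg, mul_comm]⟩
    have heB : e ∣ G' 0 1 := by
      refine ((hysq.squarefree_of_dvd hey).dvd_pow_iff_dvd two_ne_zero).1 (?_ : e ∣ G' 0 1 ^ 2)
      have : G' 0 1 ^ 2 = e * (G' 0 0 * (e * C) - a * h * (g * y)) := by
        rw [hCe] at hdet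
        rw [← heg] at hdet ⊢
        linear_combination -hdet
      exact ⟨_, this⟩
    obtain ⟨b, hb⟩ := heB
    have he0 : e ≠ 0 := by omega
    have hdet1 : G' 0 0 * C - b ^ 2 = (a * h : ℤ) * g ^ 2 := by
      rw [hCe, hb, ← heg] at hdet
      exact mul_left_cancel₀ (pow_ne_zero 2 he0) (by linear_combination hdet)
    obtain ⟨f, hf0, hfg, ⟨B, hB⟩, A, hA'⟩ := exists_shift (by omega)
      (hysq.squarefree_of_dvd hgy) ((hgy.trans hyhZ).mul_left _)
      (fun p hp hpg hpC => hmax p hp hpg (hCe ▸ hpC.mul_left _)) hdet1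
    have hg0 : g ≠ 0 := by omega
    have hdetG : A * C - B ^ 2 = (a * h : ℤ) := by
      refine mul_left_cancel₀ (pow_ne_zero 2 hg0) ?_
      linear_combination hdet1 - C * hA' + (b + f * C + g * B) * hB
    have hCpos : 0 < C := by
      rw [hCe] at hC
      exact pos_of_mul_pos_right hC (by positivity)
    have hcoe : IsCoprime ((a : ℤ) * d) e := (hcoad.of_isCoprime_of_dvd_left hey).symm
    have hadC : (a : ℤ) * d ∣ C := by
      rw [hCe] at hdC
      exact (hcoe.pow_right (n := 2)).dvd_of_dvd_mul_left hdC
    have hab : (a : ℤ) ∣ b := by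
      rw [hb] at haB
      exact hcoe.of_mul_left_left.dvd_of_dvd_mul_left haB
    have haB' : (a : ℤ) ∣ B := by
      have hcog : IsCoprime (a : ℤ) g := (hcoa.of_isCoprime_of_dvd_left hgy).symm
      refine hcog.dvd_of_dvd_mul_left (hB ▸ dvd_add hab ?_)
      exact ((dvd_mul_right _ _).trans hadC).mul_left _
    refine ⟨((e, f, g), !![A, B; B, C]), ⟨he, hg, heg, hf0, hfg, ?_, ?_⟩, ?_⟩
    · exact ⟨rfl, hdetG, pos_of_mul_sub_sq_pos hCpos (by positivity) hdetG, hCpos, hadC, haB'⟩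
    · rw [conj_yInv]
      ext i j
      fin_cases i <;> fin_cases j <;> simp
      · linear_combination hA' - 2 * f * hB
      · rw [hb]; linear_combination e * hB
      · rw [← hs, hb]; linear_combination e * hB
      · exact hCe
    · rintro ⟨⟨e₂, f₂, g₂⟩, G⟩ ⟨he₂, hg₂, heg₂, hf₂, hfg₂, ⟨hGs, hGdet, -, -, -, -⟩, hG⟩
      dsimp only at he₂ hg₂ heg₂ hf₂ hfg₂ hGs hGdet hG
      rw [conj_yInv] at hG
      have h00 : G' 0 0 = _ := congrFun (congrFun hG 0) 0
      have h01 : G' 0 1 = _ := congrFun (congrFun hG 0) 1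
      have h11 : G' 1 1 = _ := congrFun (congrFun hG 1) 1
      simp only [Matrix.of_apply, Matrix.cons_val', Matrix.cons_val_zero, Matrix.cons_val_one,
        Matrix.cons_val_fin_one] at h00 h01 h11
      have hCC : e ^ 2 * C = e₂ ^ 2 * G 1 1 := hCe.symm.trans h11
      obtain rfl : e = e₂ := Int.dvd_antisymm (by omega) (by omega)
        (dvd_of_sq_mul_eq hysq hD heg hGdet hCC)
        (dvd_of_sq_mul_eq hysq hD heg₂ hdetG hCC.symm)
      obtain rfl : g = g₂ := mul_left_cancel₀ he0 (heg.trans heg₂.symm)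
      obtain rfl : C = G 1 1 := mul_left_cancel₀ (pow_ne_zero 2 he0) hCC
      have hbe : b = g * G 0 1 - f₂ * G 1 1 := mul_left_cancel₀ he0 (hb.symm.trans h01)
      have hff : g ∣ f - f₂ := dvd_sub_of_shift_eq (hysq.squarefree_of_dvd hgy)
        (fun p hp hpg => hD p hp (hpg.trans hgy)) hdetG hGdet
        (by linear_combination hbe - hB)
      obtain rfl : f = f₂ := by
        have := Int.eq_zero_of_abs_lt_dvd hff (abs_lt.2 ⟨by omega, by omega⟩)
        omega
      have hBB : G 0 1 = B := mul_left_cancel₀ hg0 (by linear_combination hB - hbe)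
      have hAA : G 0 0 = A := by
        refine mul_left_cancel₀ hCpos.ne' ?_
        rw [hBB] at hGdet
        linear_combination hGdet - hdetG
      refine Prod.ext rfl ?_
      ext i j
      fin_cases i <;> fin_cases j <;> simp [hAA, hBB, ← hGs]
end

section
/- (Kernel bound for lower-triangular orbits) For every ε > 0 there exists C > 0 such that the following holds for all reals D, N₀, N₁, N₂, T, V, Z ≥ 1 and R > 0. For positive integers s, n₁, n₂ with gcd(n₁,n₂) = 1, a choice of integer n̄₁ with n₁n̄₁ ≡ 1 (mod n₂), and a function k : SL₂(ℝ) → ℝ with 0 ≤ k(g) ≤ 1{u_R(g) ≤ Z}·(1 + u_R(g))^{−1/2} for all g, set K(s, n₁, n₂) := Σ_{v, v' ∈ ℤ, |v| ≤ V, |v'| ≤ V} Σ_{γ ∈ Γ₀(s n₁ n₂)} k( n[s n₁ v' n̄₁]ᵗ · γ · n[−s n₁ v n̄₁]ᵗ ). Then Σ_{t ≤ T} Σ_{n₀ ≤ N₀} Σ_{n₁ ≤ N₁} Σ_{n₂ ≤ N₂, gcd(n₁,n₂)=1} Σ_{d ∣ n₀n₁n₂, d > D} K(d n₀ t², n₁,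 n₂) ≤ C · P^{ε} · ( N₀ T V (1+R)(N₁N₂ + N₁V + N₂V) + V² ( (DR)^{−1} + Z^{1/2} ) ), where P := D N₀ N₁ N₂ T V Z (2 + R + R^{−1}), uniformly over all choices of the inverses n̄₁ (one for each tuple (t, n₀, n₁, n₂, d)). -/
open Matrix
open scoped Classical

/-- The Hecke congruence subgroup `Γ₀(q)` viewed as a set of integral 2×2 matrices. -/
def Gamma0 (q : ℕ) : Set (Matrix (Fin 2) (Fin 2) ℤ) :=
  {g | g.det = 1 ∧ (q : ℤ) ∣ g 1 0}

/-- Coercion of an integral 2×2 matrix to a real one. -/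
def toR (g : Matrix (Fin 2) (Fin 2) ℤ) : Matrix (Fin 2) (Fin 2) ℝ :=
  g.map (Int.cast : ℤ → ℝ)

/-- The lower-triangular unipotent matrix `n[x]ᵗ = (1 0; x 1)`. -/
def ltu (x : ℤ) : Matrix (Fin 2) (Fin 2) ℤ := !![1, 0; x, 1]

/-- The `R`-skewed hyperbolic size `u_R(g)`. -/
noncomputable def uSize (R : ℝ) (g : Matrix (Fin 2) (Fin 2) ℝ) : ℝ :=
  ((g 0 0) ^ 2 + (g 0 1 / R) ^ 2 + (g 1 0 * R) ^ 2 + (g 1 1) ^ 2 - 2) / 4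

/-- `K(s,n₁,n₂) = Σ_{|v|,|v'| ≤ V} Σ_{γ ∈ Γ₀(sn₁n₂)} k(n[sn₁v'n̄₁]ᵗ γ n[−sn₁vn̄₁]ᵗ)`. -/
noncomputable def Kker (k : Matrix (Fin 2) (Fin 2) ℝ → ℝ) (V : ℝ) (s n₁ n₂ : ℕ)
    (nb : ℤ) : ℝ :=
  ∑' v : ℤ, ∑' v' : ℤ,
    if (|v| : ℝ) ≤ V ∧ (|v'| : ℝ) ≤ V then
      ∑' γ : Gamma0 (s * n₁ * n₂),
        k (toR (ltu ((s : ℤ) * (n₁ : ℤ) * v' * nb) * (γ : Matrix (Fin 2) (Fin 2) ℤ) *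
            ltu (-((s : ℤ) * (n₁ : ℤ) * v * nb))))
    else 0

section Divisors

/-- The divisor bound `τ(n) ≪ n ^ δ`. -/
theorem exists_card_divisors_le (δ : ℝ) (hδ : 0 < δ) :
    ∃ C : ℝ, 1 ≤ C ∧ ∀ n : ℕ, n ≠ 0 → (n.divisors.card : ℝ) ≤ C * (n : ℝ) ^ δ := by
  set c : ℝ := min 1 (δ * Real.log 2) with hc
  have hlog : 0 < Real.log 2 := Real.log_pos (by norm_num)
  have hc0 : 0 < c := lt_min one_pos (by positivity)
  have hc1 : c ≤ 1 := min_le_left _ _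
  have hA : 1 ≤ c⁻¹ := (one_le_inv₀ hc0).2 hc1
  obtain ⟨B, hB⟩ := exists_nat_gt ((2 : ℝ) ^ δ⁻¹)
  refine ⟨c⁻¹ ^ B, one_le_pow₀ hA, fun n hn => ?_⟩
  have hpow : (n : ℝ) ^ δ
      = ∏ p ∈ n.primeFactors, ((p : ℝ) ^ δ) ^ (n.factorization p) := by
    conv_lhs => rw [← Nat.prod_factorization_pow_eq_self hn]
    rw [Finsupp.prod, Nat.support_factorization, Nat.cast_prod,
      ← Real.finsetProd_rpow _ _ (fun p _ => by positivity)]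
    refine Finset.prod_congr rfl fun p _ => ?_
    push_cast
    rw [← Real.rpow_natCast, ← Real.rpow_natCast, ← Real.rpow_mul (by positivity),
      ← Real.rpow_mul (by positivity), mul_comm]
  have hfac : ∀ p ∈ n.primeFactors, ((n.factorization p + 1 : ℕ) : ℝ)
      ≤ (if p < B then c⁻¹ else 1) * ((p : ℝ) ^ δ) ^ (n.factorization p) := by
    intro p hp
    have hp2 : (2 : ℝ) ≤ p := by exact_mod_cast (Nat.prime_of_mem_primeFactors hp).two_le
    set a := n.factorization p
    split_ifs with hpB
    · have h1 : c * (a + 1) ≤ ((p : ℝ) ^ δ) ^ a := by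
        calc c * (a + 1) ≤ a * (δ * Real.log 2) + 1 := by
              have : c ≤ δ * Real.log 2 := min_le_right _ _
              nlinarith [mul_le_mul_of_nonneg_left this (Nat.cast_nonneg (α := ℝ) a)]
          _ ≤ Real.exp (a * (δ * Real.log 2)) := Real.add_one_le_exp _
          _ = ((2 : ℝ) ^ δ) ^ a := by
              rw [Real.exp_nat_mul, Real.rpow_def_of_pos (by norm_num), mul_comm δ]
          _ ≤ _ := by gcongr
      rw [inv_mul_eq_div, le_div_iff₀ hc0]
      push_cast
      linarith
    · have h2 : (2 : ℝ) ≤ (p : ℝ) ^ δ := by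
        have h3 : (2 : ℝ) ^ δ⁻¹ ≤ p := hB.le.trans (by exact_mod_cast not_lt.1 hpB)
        calc (2 : ℝ) = ((2 : ℝ) ^ δ⁻¹) ^ δ := by
              rw [← Real.rpow_mul (by norm_num), inv_mul_cancel₀ hδ.ne', Real.rpow_one]
          _ ≤ _ := by gcongr
      rw [one_mul]
      calc ((a + 1 : ℕ) : ℝ) ≤ ((2 ^ a : ℕ) : ℝ) := by
            exact_mod_cast Nat.lt_two_pow_self
        _ = (2 : ℝ) ^ a := by push_cast; rfl
        _ ≤ _ := by gcongr
  rw [Nat.card_divisors hn, Nat.cast_prod, hpow]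
  refine (Finset.prod_le_prod (fun _ _ => by positivity) hfac).trans ?_
  rw [Finset.prod_mul_distrib]
  gcongr
  rw [← Finset.prod_filter, Finset.prod_const]
  refine pow_le_pow_right₀ hA ?_
  calc _ ≤ (Finset.range B).card := Finset.card_le_card fun p hp => by
        simp only [Finset.mem_filter] at hp; simpa using hp.2
    _ = B := Finset.card_range B

/-- The position of `m` among the divisors of `n` in `ℤ`. -/
noncomputable def divisorRank (n m : ℤ) : ℕ := ((Finset.Ico (-|n|) m).filter (· ∣ n)).card

theorem divisorRank_lt {n m : ℤ} (hn : n ≠ 0) (hm : m ∣ n) :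
    divisorRank n m < 2 * n.natAbs.divisors.card := by
  set U := n.natAbs.divisors.image (fun k : ℕ => (k : ℤ)) ∪
    n.natAbs.divisors.image (fun k : ℕ => -(k : ℤ)) with hU
  have hmem : ∀ k : ℤ, k ∣ n → k ∈ U := by
    intro k hk
    have hk' : k.natAbs ∈ n.natAbs.divisors :=
      Nat.mem_divisors.2 ⟨Int.natAbs_dvd_natAbs.2 hk, Int.natAbs_ne_zero.2 hn⟩
    rw [hU, Finset.mem_union, Finset.mem_image, Finset.mem_image]
    rcases Int.natAbs_eq k with h | h
    · exact Or.inl ⟨_, hk', h.symm⟩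
    · exact Or.inr ⟨_, hk', h.symm⟩
  have hlt : divisorRank n m < U.card := by
    refine Finset.card_lt_card ((Finset.ssubset_iff_of_subset ?_).2 ⟨m, hmem m hm, by simp⟩)
    intro k hk
    exact hmem k (Finset.mem_filter.1 hk).2
  refine hlt.trans_le ((Finset.card_union_le _ _).trans ?_)
  have h1 := Finset.card_image_le (s := n.natAbs.divisors) (f := fun k : ℕ => (k : ℤ))
  have h2 := Finset.card_image_le (s := n.natAbs.divisors) (f := fun k : ℕ => -(k : ℤ))
  omega

theorem divisorRank_strictMono {n m m' : ℤ} (hn : n ≠ 0) (hm : m ∣ n) (h : m < m') :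
    divisorRank n m < divisorRank n m' := by
  refine Finset.card_lt_card ((Finset.ssubset_iff_of_subset ?_).2 ⟨m, ?_, by simp⟩)
  · exact Finset.filter_subset_filter _ (Finset.Ico_subset_Ico_right h.le)
  · have h1 : |m| ≤ |n| := Int.le_of_dvd (abs_pos.2 hn) ((abs_dvd_abs _ _).2 hm)
    exact Finset.mem_filter.2 ⟨Finset.mem_Ico.2 ⟨by linarith [neg_abs_le m], h⟩, hm⟩

theorem divisorRank_inj {n m m' : ℤ} (hn : n ≠ 0) (hm : m ∣ n) (hm' : m' ∣ n)
    (h : divisorRank n m = divisorRank n m') : m = m' := by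
  rcases lt_trichotomy m m' with h1 | h1 | h1
  · exact absurd h (divisorRank_strictMono hn hm h1).ne
  · exact h1
  · exact absurd h (ne_of_gt (divisorRank_strictMono hn hm' h1))

/-- `Σ_{|y| ≤ M} 1 / max(1, |y|)`. -/
noncomputable def symmHarmonic (M : ℕ) : ℝ :=
  ∑ y ∈ Finset.Icc (-(M : ℤ)) M, (max 1 |(y : ℝ)|)⁻¹

theorem symmHarmonic_le (M : ℕ) : symmHarmonic M ≤ 3 + 2 * Real.log M := by
  have key : symmHarmonic M ≤ 1 + 2 * (harmonic M : ℝ) := by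
    induction M with
    | zero => simp [symmHarmonic]
    | succ M ih =>
      have hset : Finset.Icc (-((M + 1 : ℕ) : ℤ)) ((M + 1 : ℕ) : ℤ)
          = insert (-((M : ℤ) + 1)) (insert ((M : ℤ) + 1) (Finset.Icc (-(M : ℤ)) M)) := by
        ext y
        simp only [Finset.mem_Icc, Finset.mem_insert]
        push_cast
        omega
      have hmax : max 1 |(M : ℝ) + 1| = M + 1 := by
        rw [abs_of_nonneg (by positivity)]
        exact max_eq_right (by linarith [Nat.cast_nonneg (α := ℝ) M])
      unfold symmHarmonic at ih ⊢
      rw [hset, Finset.sum_insert (by simp; omega), Finset.sum_insert (by simp)]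
      push_cast
      rw [harmonic_succ, abs_neg, hmax]
      push_cast
      linarith
  linarith [harmonic_le_one_add_log M]

theorem one_le_symmHarmonic (M : ℕ) : 1 ≤ symmHarmonic M := by
  have h := Finset.single_le_sum (f := fun y : ℤ => (max 1 |(y : ℝ)|)⁻¹)
    (s := Finset.Icc (-(M : ℤ)) M) (fun y _ => by positivity) (a := 0) (by simp)
  simpa [symmHarmonic] using h

end Divisors

section Counting

/-- If `w x ≤ κ / max(1, |f x|)` and `x` is determined by `f x` and a label `g x ∈ F`, then the
sum of `w` is at most `#F · κ · Σ 1 / max(1, |y|)`. -/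
theorem sum_le_card_mul_symmHarmonic {α β : Type*} {M : ℕ} {κ : ℝ} (S : Finset α) (w : α → ℝ)
    (F : Finset β) (g : α → β) (f : α → ℤ) (hκ : 0 ≤ κ) (hg : ∀ x ∈ S, g x ∈ F)
    (hf : ∀ x ∈ S, |f x| ≤ M)
    (hinj : ∀ x ∈ S, ∀ y ∈ S, g x = g y → f x = f y → x = y)
    (hw : ∀ x ∈ S, w x * max 1 |(f x : ℝ)| ≤ κ) :
    ∑ x ∈ S, w x ≤ F.card * (κ * symmHarmonic M) := by
  have hinj' : Set.InjOn (fun x => (g x, f x)) (S : Set α) := by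
    intro x hx y hy h
    exact hinj x hx y hy (congrArg Prod.fst h) (congrArg Prod.snd h)
  calc ∑ x ∈ S, w x ≤ ∑ x ∈ S, κ * (max 1 |(f x : ℝ)|)⁻¹ := by
        refine Finset.sum_le_sum fun x hx => ?_
        rw [← div_eq_mul_inv, le_div_iff₀ (by positivity)]
        exact hw x hx
    _ = ∑ q ∈ S.image (fun x => (g x, f x)), κ * (max 1 |(q.2 : ℝ)|)⁻¹ :=
        (Finset.sum_image (f := fun q : β × ℤ => κ * (max 1 |(q.2 : ℝ)|)⁻¹) hinj').symm
    _ ≤ ∑ q ∈ F ×ˢ Finset.Icc (-(M : ℤ)) M, κ * (max 1 |(q.2 : ℝ)|)⁻¹ := by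
        refine Finset.sum_le_sum_of_subset_of_nonneg ?_ fun q _ _ => by positivity
        intro q hq
        obtain ⟨x, hx, rfl⟩ := Finset.mem_image.1 hq
        exact Finset.mem_product.2 ⟨hg x hx, Finset.mem_Icc.2 (abs_le.1 (hf x hx))⟩
    _ = F.card * (κ * symmHarmonic M) := by
        rw [Finset.sum_product]
        dsimp only
        rw [Finset.sum_const, nsmul_eq_mul, symmHarmonic, ← Finset.mul_sum]

/-- The positive integers up to `x`. -/
noncomputable def posUpTo (x : ℝ) : Finset ℕ := Finset.Icc 1 ⌊x⌋₊

theorem mem_posUpTo {x : ℝ} {n : ℕ} : n ∈ posUpTo x ↔ 1 ≤ n ∧ (n : ℝ) ≤ x := by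
  rw [posUpTo, Finset.mem_Icc]
  constructor
  · rintro ⟨h1, h2⟩
    exact ⟨h1, (Nat.le_floor_iff' (by omega)).1 h2⟩
  · rintro ⟨h1, h2⟩
    exact ⟨h1, Nat.le_floor h2⟩

theorem card_posUpTo_le {x : ℝ} (hx : 0 ≤ x) : ((posUpTo x).card : ℝ) ≤ x := by
  simpa [posUpTo] using Nat.floor_le hx

/-- The integers of absolute value at most `x`. -/
noncomputable def absUpTo (x : ℝ) : Finset ℤ := Finset.Icc (-⌊x⌋) ⌊x⌋

theorem mem_absUpTo {x : ℝ} {n : ℤ} : n ∈ absUpTo x ↔ |(n : ℝ)| ≤ x := by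
  rw [absUpTo, Finset.mem_Icc, ← abs_le, Int.le_floor]
  push_cast
  rfl

theorem card_absUpTo_le {x : ℝ} (hx : 1 ≤ x) : ((absUpTo x).card : ℝ) ≤ 3 * x := by
  have h0 : 0 ≤ ⌊x⌋ := Int.floor_nonneg.2 (by linarith)
  have h1 : ((absUpTo x).card : ℤ) = 2 * ⌊x⌋ + 1 := by
    rw [absUpTo, Int.card_Icc, Int.toNat_of_nonneg (by omega)]
    ring
  have h2 : ((absUpTo x).card : ℝ) = 2 * ⌊x⌋ + 1 := by exact_mod_cast h1
  linarith [Int.floor_le x]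

end Counting

section Configurations

/-- The data of one summand: the outer variables together with the matrix
`(a b; d n₀ t² n₁ c  e)`. -/
structure OrbitPoint where
  (t n₀ n₁ n₂ d : ℕ)
  (v v' a b c e : ℤ)

namespace OrbitPoint

/-- The integer whose divisibility by `n₂` characterises the matrices in the orbit. -/
def residue (x : OrbitPoint) : ℤ :=
  x.n₁ * x.c - x.v' * x.a + x.v * x.e - (x.d * x.n₀ * x.t ^ 2) * x.v * x.v' * x.b

/-- The matrix attached to an orbit point. -/
def mat (x : OrbitPoint) : Matrix (Fin 2) (Fin 2) ℝ :=
  !![(x.a : ℝ), x.b; x.d * x.n₀ * x.t ^ 2 * x.n₁ * x.c, x.e]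

/-- The majorant `(1 + u_R)^{-1/2}` at an orbit point. -/
noncomputable def wt (R : ℝ) (x : OrbitPoint) : ℝ := (1 + uSize R x.mat) ^ (-(1 : ℝ) / 2)

/-- The constraints cut out by the summation ranges. -/
structure Admissible (D N₀ N₁ N₂ T V Z R : ℝ) (x : OrbitPoint) : Prop where
  t_pos : 1 ≤ x.t
  t_le : (x.t : ℝ) ≤ T
  n₀_pos : 1 ≤ x.n₀
  n₀_le : (x.n₀ : ℝ) ≤ N₀
  n₁_pos : 1 ≤ x.n₁
  n₁_le : (x.n₁ : ℝ) ≤ N₁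
  n₂_pos : 1 ≤ x.n₂
  n₂_le : (x.n₂ : ℝ) ≤ N₂
  d_dvd : x.d ∣ x.n₀ * x.n₁ * x.n₂
  d_gt : D < x.d
  v_le : |(x.v : ℝ)| ≤ V
  v'_le : |(x.v' : ℝ)| ≤ V
  det : x.a * x.e - x.b * (x.d * x.n₀ * x.t ^ 2 * x.n₁ * x.c) = 1
  dvd : (x.n₂ : ℤ) ∣ x.residue
  uSize_le : uSize R x.mat ≤ Z

/-- All integers whose divisors get counted are at most `M`. -/
structure BoundedBy (M : ℕ) (x : OrbitPoint) : Prop where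
  prod : |(x.n₀ * x.n₁ * x.n₂ : ℤ)| ≤ M
  prod₂ : |(x.n₀ * x.n₁ : ℤ)| ≤ M
  residue : |x.residue| ≤ M
  diag : |x.a * x.e - 1| ≤ M
  diff : |x.v' - x.v| ≤ M
  a_le : |x.a| ≤ M
  e_le : |x.e| ≤ M
  b_le : |x.b| ≤ M
  a_sub : ∀ η : ℤ, η = 1 ∨ η = -1 → |x.a - η| ≤ M
  e_sub : ∀ η : ℤ, η = 1 ∨ η = -1 → |x.e - η| ≤ M
  low : |(x.t * x.n₀ * x.n₁ * x.c : ℤ)| ≤ M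

section Weight

variable {Z R : ℝ} {x : OrbitPoint}

theorem one_add_uSize (R : ℝ) (x : OrbitPoint) : 1 + uSize R x.mat =
    ((x.a : ℝ) ^ 2 + (x.b / R) ^ 2 + (x.d * x.n₀ * x.t ^ 2 * x.n₁ * x.c * R) ^ 2
      + (x.e : ℝ) ^ 2 + 2) / 4 := by
  simp [uSize, mat]
  ring

theorem wt_nonneg : 0 ≤ x.wt R := by
  have : 0 ≤ 1 + uSize R x.mat := by rw [one_add_uSize]; positivity
  exact Real.rpow_nonneg this _

theorem wt_mul_le {y : ℝ} (hy : y ^ 2 ≤ 4 * (1 + uSize R x.mat)) : x.wt R * |y| ≤ 2 := by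
  have h0 : 0 < 1 + uSize R x.mat := by rw [one_add_uSize]; positivity
  have h1 : |y| ≤ 2 * √(1 + uSize R x.mat) := by
    refine Real.abs_le_sqrt hy |>.trans_eq ?_
    rw [Real.sqrt_mul (by norm_num), show (4 : ℝ) = 2 ^ 2 by norm_num,
      Real.sqrt_sq (by norm_num)]
  have h2 : x.wt R = (√(1 + uSize R x.mat))⁻¹ := by
    rw [wt, Real.sqrt_eq_rpow, ← Real.rpow_neg h0.le]
    norm_num
  rw [h2, inv_mul_le_iff₀ (Real.sqrt_pos.2 h0)]
  linarith

theorem wt_le : x.wt R ≤ 2 := by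
  have := wt_mul_le (R := R) (x := x) (y := 1) (by
    rw [one_add_uSize]
    nlinarith [sq_nonneg (x.a : ℝ), sq_nonneg ((x.b : ℝ) / R), sq_nonneg (x.e : ℝ),
      sq_nonneg ((x.d * x.n₀ * x.t ^ 2 * x.n₁ * x.c * R : ℝ))])
  simpa using this

theorem wt_mul_a_le : x.wt R * max 1 |(x.a : ℝ)| ≤ 2 := by
  rcases max_choice 1 |(x.a : ℝ)| with h | h <;> rw [h]
  · simpa using wt_le
  · refine wt_mul_le ?_
    rw [one_add_uSize]
    nlinarith [sq_nonneg ((x.b : ℝ) / R),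
      sq_nonneg ((x.d * x.n₀ * x.t ^ 2 * x.n₁ * x.c * R : ℝ)), sq_nonneg (x.e : ℝ)]

theorem wt_mul_e_le : x.wt R * max 1 |(x.e : ℝ)| ≤ 2 := by
  rcases max_choice 1 |(x.e : ℝ)| with h | h <;> rw [h]
  · simpa using wt_le
  · refine wt_mul_le ?_
    rw [one_add_uSize]
    nlinarith [sq_nonneg ((x.b : ℝ) / R),
      sq_nonneg ((x.d * x.n₀ * x.t ^ 2 * x.n₁ * x.c * R : ℝ)), sq_nonneg (x.a : ℝ)]

theorem wt_mul_b_le (hR : 0 < R) : x.wt R * max 1 |(x.b : ℝ)| ≤ 2 * (1 + R) := by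
  rcases max_choice 1 |(x.b : ℝ)| with h | h <;> rw [h]
  · linarith [wt_le (R := R) (x := x)]
  · have : x.wt R * |(x.b : ℝ) / R| ≤ 2 := by
      refine wt_mul_le ?_
      rw [one_add_uSize]
      nlinarith [sq_nonneg (x.a : ℝ),
        sq_nonneg ((x.d * x.n₀ * x.t ^ 2 * x.n₁ * x.c * R : ℝ)), sq_nonneg (x.e : ℝ)]
    rw [abs_div, abs_of_pos hR, ← mul_div_assoc, div_le_iff₀ hR] at this
    linarith

theorem wt_mul_low_le : x.wt R * |(x.d * x.n₀ * x.t ^ 2 * x.n₁ * x.c * R : ℝ)| ≤ 2 := by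
  refine wt_mul_le ?_
  rw [one_add_uSize]
  nlinarith [sq_nonneg (x.a : ℝ), sq_nonneg ((x.b : ℝ) / R), sq_nonneg (x.e : ℝ)]

end Weight

section Cases

variable {D N₀ N₁ N₂ T V Z R : ℝ} {K M : ℕ}

/-- `K` bounds the number of divisors in `ℤ` of every nonzero integer up to `M`. -/
def DivisorCountLE (K M : ℕ) : Prop :=
  ∀ n : ℤ, n ≠ 0 → |n| ≤ M → 2 * n.natAbs.divisors.card ≤ K

theorem DivisorCountLE.mem_range (hK : DivisorCountLE K M) {n m : ℤ} (hn : n ≠ 0)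
    (hM : |n| ≤ M) (hm : m ∣ n) : divisorRank n m ∈ Finset.range K :=
  Finset.mem_range.2 ((divisorRank_lt hn hm).trans_le (hK n hn hM))

theorem eq_of_mul_eq_one {a e : ℤ} (h : a * e = 1) : a ∈ ({1, -1} : Finset ℤ) ∧ e = a := by
  rcases Int.mul_eq_one_iff_eq_one_or_neg_one.1 h with ⟨rfl, rfl⟩ | ⟨rfl, rfl⟩ <;> simp

theorem cast_card_sign : ((({1, -1} : Finset ℤ).card : ℕ) : ℝ) = 2 := by norm_num

theorem Admissible.ne_zero {x : OrbitPoint} (h : Admissible D N₀ N₁ N₂ T V Z R x) :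
    (x.t : ℤ) ≠ 0 ∧ (x.n₀ : ℤ) ≠ 0 ∧ (x.n₁ : ℤ) ≠ 0 ∧ (x.n₂ : ℤ) ≠ 0 ∧ (x.d : ℤ) ≠ 0 ∧
      (x.n₀ * x.n₁ * x.n₂ : ℤ) ≠ 0 := by
  have := h.t_pos
  have h0 := h.n₀_pos
  have h1 := h.n₁_pos
  have h2 := h.n₂_pos
  have hn : x.n₀ * x.n₁ * x.n₂ ≠ 0 := by positivity
  have hd : x.d ≠ 0 := fun h0 => hn (Nat.eq_zero_of_zero_dvd (h0 ▸ h.d_dvd))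
  refine ⟨by omega, by omega, by omega, by omega, by omega, by exact_mod_cast hn⟩

theorem Admissible.d_dvd_int {x : OrbitPoint} (h : Admissible D N₀ N₁ N₂ T V Z R x) :
    (x.d : ℤ) ∣ (x.n₀ * x.n₁ * x.n₂ : ℤ) := by
  exact_mod_cast h.d_dvd

theorem Admissible.mul_eq_one_of_c {x : OrbitPoint} (h : Admissible D N₀ N₁ N₂ T V Z R x)
    (hc : x.c = 0) : x.a * x.e = 1 := by
  simpa [hc] using h.det

theorem Admissible.mul_eq_one_of_b {x : OrbitPoint} (h : Admissible D N₀ N₁ N₂ T V Z R x)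
    (hb : x.b = 0) : x.a * x.e = 1 := by
  simpa [hb] using h.det

theorem Admissible.diag_eq {x : OrbitPoint} (h : Admissible D N₀ N₁ N₂ T V Z R x) :
    x.a * x.e - 1 = x.b * (x.d * x.n₀ * x.t ^ 2 * x.n₁ * x.c) := by
  linear_combination h.det

theorem Admissible.diag_ne_zero {x : OrbitPoint} (h : Admissible D N₀ N₁ N₂ T V Z R x)
    (hb : x.b ≠ 0) (hc : x.c ≠ 0) : x.a * x.e - 1 ≠ 0 := by
  obtain ⟨ht, h0, h1, -, hd, -⟩ := h.ne_zero
  rw [h.diag_eq]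
  positivity

theorem Admissible.mul_eq_one_of_residue {x : OrbitPoint}
    (h : Admissible D N₀ N₁ N₂ T V Z R x) (hr : x.residue = 0) :
    (x.a + x.d * x.n₀ * x.t ^ 2 * x.b * x.v) * (x.e - x.d * x.n₀ * x.t ^ 2 * x.b * x.v') = 1 := by
  rw [residue] at hr
  linear_combination h.det + x.d * x.n₀ * x.t ^ 2 * x.b * hr

/-- Upper triangular matrices with `v = v'`. -/
theorem sum_wt_le_of_c_eq_zero_of_eq (hK : DivisorCountLE K M) (hV : 1 ≤ V) (hN₀ : 1 ≤ N₀)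
    (hN₁ : 1 ≤ N₁) (hN₂ : 1 ≤ N₂) (hT : 1 ≤ T) (hR : 0 < R)
    (S : Finset OrbitPoint)
    (hS : ∀ x ∈ S, Admissible D N₀ N₁ N₂ T V Z R x ∧ BoundedBy M x ∧ x.c = 0 ∧ x.v = x.v') :
    ∑ x ∈ S, x.wt R ≤ (T * (N₀ * (N₁ * (N₂ * ((3 * V) * (2 * K)))))) *
      ((2 * (1 + R)) * symmHarmonic M) := by
  have hL := one_le_symmHarmonic M
  refine (sum_le_card_mul_symmHarmonic (M := M) (κ := (2 * (1 + R))) S (wt R)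
    (posUpTo T ×ˢ posUpTo N₀ ×ˢ posUpTo N₁ ×ˢ posUpTo N₂ ×ˢ absUpTo V ×ˢ ({1, -1} : Finset ℤ) ×ˢ
      Finset.range K)
    (fun x => (x.t, x.n₀, x.n₁, x.n₂, x.v, x.a, divisorRank (x.n₀ * x.n₁ * x.n₂) x.d))
    (fun x => x.b) (by positivity) ?_ ?_ ?_ ?_).trans ?_
  · intro x hx
    simp only [Finset.mem_product, mem_posUpTo, mem_absUpTo]
    obtain ⟨h, hB, hc, hv⟩ := hS x hx
    obtain ⟨ht0, hn₀0, hn₁0, hn₂0, hd0, hn⟩ := h.ne_zero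
    exact ⟨⟨h.t_pos, h.t_le⟩, ⟨h.n₀_pos, h.n₀_le⟩, ⟨h.n₁_pos, h.n₁_le⟩, ⟨h.n₂_pos, h.n₂_le⟩,
      h.v_le, (eq_of_mul_eq_one (h.mul_eq_one_of_c hc)).1, hK.mem_range hn hB.prod h.d_dvd_int⟩
  · intro x hx
    exact (hS x hx).2.1.b_le
  · rintro ⟨t, n₀, n₁, n₂, d, v, v', a, b, c, e⟩ hx
      ⟨t', n₀', n₁', n₂', d', w, w', a', b', c', e'⟩ hy hg hf
    obtain ⟨h, -, hc, hv⟩ := hS _ hx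
    obtain ⟨h', -, hc', hv'⟩ := hS _ hy
    obtain ⟨-, -, -, -, -, hn⟩ := h.ne_zero
    have hae := (eq_of_mul_eq_one (h.mul_eq_one_of_c hc)).2.symm
    have hae' := (eq_of_mul_eq_one (h'.mul_eq_one_of_c hc')).2.symm
    have hA := h.mul_eq_one_of_c hc
    have hd := h.d_dvd_int
    have hd' := h'.d_dvd_int
    simp only [Prod.mk.injEq] at hg hf hc hc' hv hv' hn hd hd' hae hae' hA
    obtain ⟨rfl, rfl, rfl, rfl, rfl, rfl, hr⟩ := hg
    subst hc hc' hf hae hae'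
    obtain rfl : d = d' := by exact_mod_cast divisorRank_inj hn hd hd' hr
    rw [← hv, ← hv']
  · intro x hx
    exact wt_mul_b_le hR
  · simp only [Finset.card_product, Finset.card_range]
    push_cast
    rw [cast_card_sign]
    gcongr <;> first | exact card_posUpTo_le (by linarith) | exact card_absUpTo_le ‹_›

/-- Upper triangular matrices with vanishing residue. -/
theorem sum_wt_le_of_c_eq_zero_of_residue (hK : DivisorCountLE K M) (hV : 1 ≤ V) (hN₀ : 1 ≤ N₀)
    (hN₁ : 1 ≤ N₁) (hN₂ : 1 ≤ N₂) (hT : 1 ≤ T) (hR : 0 < R)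
    (S : Finset OrbitPoint)
    (hS : ∀ x ∈ S, Admissible D N₀ N₁ N₂ T V Z R x ∧ BoundedBy M x ∧ x.c = 0 ∧ x.residue = 0) :
    ∑ x ∈ S, x.wt R ≤ (T * (N₀ * (N₁ * (N₂ * ((3 * V) * (2 * K)))))) *
      ((2 * (1 + R)) * symmHarmonic M) := by
  have hL := one_le_symmHarmonic M
  refine (sum_le_card_mul_symmHarmonic (M := M) (κ := (2 * (1 + R))) S (wt R)
    (posUpTo T ×ˢ posUpTo N₀ ×ˢ posUpTo N₁ ×ˢ posUpTo N₂ ×ˢ absUpTo V ×ˢ ({1, -1} : Finset ℤ) ×ˢ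
      Finset.range K)
    (fun x => (x.t, x.n₀, x.n₁, x.n₂, x.v, x.a, divisorRank (x.n₀ * x.n₁ * x.n₂) x.d))
    (fun x => x.b) (by positivity) ?_ ?_ ?_ ?_).trans ?_
  · intro x hx
    simp only [Finset.mem_product, mem_posUpTo, mem_absUpTo]
    obtain ⟨h, hB, hc, hv⟩ := hS x hx
    obtain ⟨ht0, hn₀0, hn₁0, hn₂0, hd0, hn⟩ := h.ne_zero
    exact ⟨⟨h.t_pos, h.t_le⟩, ⟨h.n₀_pos, h.n₀_le⟩, ⟨h.n₁_pos, h.n₁_le⟩, ⟨h.n₂_pos, h.n₂_le⟩,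
      h.v_le, (eq_of_mul_eq_one (h.mul_eq_one_of_c hc)).1, hK.mem_range hn hB.prod h.d_dvd_int⟩
  · intro x hx
    exact (hS x hx).2.1.b_le
  · rintro ⟨t, n₀, n₁, n₂, d, v, v', a, b, c, e⟩ hx
      ⟨t', n₀', n₁', n₂', d', w, w', a', b', c', e'⟩ hy hg hf
    obtain ⟨h, -, hc, hv⟩ := hS _ hx
    obtain ⟨h', -, hc', hv'⟩ := hS _ hy
    obtain ⟨-, -, -, -, -, hn⟩ := h.ne_zero
    have hae := (eq_of_mul_eq_one (h.mul_eq_one_of_c hc)).2.symm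
    have hae' := (eq_of_mul_eq_one (h'.mul_eq_one_of_c hc')).2.symm
    have hA := h.mul_eq_one_of_c hc
    have hd := h.d_dvd_int
    have hd' := h'.d_dvd_int
    simp only [Prod.mk.injEq] at hg hf hc hc' hv hv' hn hd hd' hae hae' hA
    obtain ⟨rfl, rfl, rfl, rfl, rfl, rfl, hr⟩ := hg
    subst hc hc' hf hae hae'
    obtain rfl : d = d' := by exact_mod_cast divisorRank_inj hn hd hd' hr
    simp only [residue] at hv hv'
    have hne : a + d * n₀ * t ^ 2 * v * b ≠ 0 := by
      intro h0
      have hv0 : v * a = 0 := by linear_combination hv + v' * h0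
      have ha0 : a ≠ 0 := by rintro rfl; simp at hA
      have hv1 : v = 0 := (mul_eq_zero.1 hv0).resolve_right ha0
      subst hv1
      exact ha0 (by simpa using h0)
    obtain rfl : v' = w' := by
      refine mul_right_cancel₀ hne ?_
      linear_combination hv' - hv
    rfl
  · intro x hx
    exact wt_mul_b_le hR
  · simp only [Finset.card_product, Finset.card_range]
    push_cast
    rw [cast_card_sign]
    gcongr <;> first | exact card_posUpTo_le (by linarith) | exact card_absUpTo_le ‹_›

theorem Admissible.div_gcd_dvd {x : OrbitPoint} (h : Admissible D N₀ N₁ N₂ T V Z R x)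
    (hc : x.c = 0) : ((x.d / x.d.gcd (x.n₀ * x.n₁) : ℕ) : ℤ) ∣ x.v' - x.v := by
  obtain ⟨ha, he⟩ := eq_of_mul_eq_one (h.mul_eq_one_of_c hc)
  obtain ⟨-, -, -, -, hd, -⟩ := h.ne_zero
  have hpos : 0 < x.d.gcd (x.n₀ * x.n₁) := Nat.gcd_pos_of_pos_left _ (by omega)
  have hdvd : x.d / x.d.gcd (x.n₀ * x.n₁) ∣ x.n₂ := by
    refine (Nat.coprime_div_gcd_div_gcd hpos).dvd_of_dvd_mul_left ?_
    rw [← Nat.mul_div_right_comm (Nat.gcd_dvd_right _ _)]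
    exact Nat.div_dvd_div (Nat.gcd_dvd_left _ _) h.d_dvd
  have h1 : ((x.d / x.d.gcd (x.n₀ * x.n₁) : ℕ) : ℤ) ∣ x.residue :=
    (Int.natCast_dvd_natCast.2 hdvd).trans h.dvd
  have h2 : ((x.d / x.d.gcd (x.n₀ * x.n₁) : ℕ) : ℤ) ∣ x.d :=
    Int.natCast_dvd_natCast.2 (Nat.div_dvd_of_dvd (Nat.gcd_dvd_left _ _))
  have h3 : x.v' - x.v = -x.a * x.residue
      - x.a * (x.n₀ * x.t ^ 2 * x.v * x.v' * x.b) * x.d := by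
    have ha2 := h.mul_eq_one_of_c hc
    rw [he] at ha2
    rw [residue, he, hc]
    linear_combination (-(x.v' - x.v)) * ha2
  rw [h3]
  exact dvd_sub (h1.mul_left _) (h2.mul_left _)

/-- Upper triangular matrices with nonzero residue. -/
theorem sum_wt_le_of_c_eq_zero_of_ne (hK : DivisorCountLE K M) (hV : 1 ≤ V) (hN₀ : 1 ≤ N₀)
    (hN₁ : 1 ≤ N₁) (hT : 1 ≤ T) (hR : 0 < R)
    (S : Finset OrbitPoint)
    (hS : ∀ x ∈ S, Admissible D N₀ N₁ N₂ T V Z R x ∧ BoundedBy M x ∧ x.c = 0 ∧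
      x.v' ≠ x.v ∧ x.residue ≠ 0) :
    ∑ x ∈ S, x.wt R ≤ (T * (N₀ * (N₁ * ((3 * V) * ((3 * V) * (2 * (K * (K * K)))))))) *
      ((2 * (1 + R)) * symmHarmonic M) := by
  have hL := one_le_symmHarmonic M
  refine (sum_le_card_mul_symmHarmonic (M := M) (κ := (2 * (1 + R))) S (wt R)
    (posUpTo T ×ˢ posUpTo N₀ ×ˢ posUpTo N₁ ×ˢ absUpTo V ×ˢ absUpTo V ×ˢ ({1, -1} : Finset ℤ) ×ˢ
      Finset.range K ×ˢ Finset.range K ×ˢ Finset.range K)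
    (fun x => (x.t, x.n₀, x.n₁, x.v, x.v', x.a,
      divisorRank (x.n₀ * x.n₁) (x.d.gcd (x.n₀ * x.n₁) : ℕ),
      divisorRank (x.v' - x.v) (x.d / x.d.gcd (x.n₀ * x.n₁) : ℕ), divisorRank x.residue x.n₂))
    (fun x => x.b) (by positivity) ?_ ?_ ?_ ?_).trans ?_
  · intro x hx
    simp only [Finset.mem_product, mem_posUpTo, mem_absUpTo]
    obtain ⟨h, hB, hc, hv, hr⟩ := hS x hx
    obtain ⟨ht0, hn₀0, hn₁0, hn₂0, hd0, hn⟩ := h.ne_zero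
    exact ⟨⟨h.t_pos, h.t_le⟩, ⟨h.n₀_pos, h.n₀_le⟩, ⟨h.n₁_pos, h.n₁_le⟩, h.v_le, h.v'_le,
      (eq_of_mul_eq_one (h.mul_eq_one_of_c hc)).1,
      hK.mem_range (mul_ne_zero hn₀0 hn₁0) hB.prod₂ (by exact_mod_cast Nat.gcd_dvd_right _ _),
      hK.mem_range (sub_ne_zero.2 hv) hB.diff (h.div_gcd_dvd hc), hK.mem_range hr hB.residue h.dvd⟩
  · intro x hx
    exact (hS x hx).2.1.b_le
  · rintro ⟨t, n₀, n₁, n₂, d, v, v', a, b, c, e⟩ hx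
      ⟨t', n₀', n₁', n₂', d', w, w', a', b', c', e'⟩ hy hg hf
    obtain ⟨h, -, hc, hv, hr⟩ := hS _ hx
    obtain ⟨h', -, hc', hv', hr'⟩ := hS _ hy
    obtain ⟨-, hn₀, hn₁, -, -, -⟩ := h.ne_zero
    have hae := (eq_of_mul_eq_one (h.mul_eq_one_of_c hc)).2.symm
    have hae' := (eq_of_mul_eq_one (h'.mul_eq_one_of_c hc')).2.symm
    have hd := h.div_gcd_dvd hc
    have hd' := h'.div_gcd_dvd hc'
    have hn₂ := h.dvd
    have hn₂' := h'.dvd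
    simp only [Prod.mk.injEq] at hg hf hc hc' hv hn₀ hn₁ hd hd' hae hae' hn₂ hn₂'
    obtain ⟨rfl, rfl, rfl, rfl, rfl, rfl, hg₁, hg₂, hg₃⟩ := hg
    subst hc hc' hf hae hae'
    have h1 : d.gcd (n₀ * n₁) = d'.gcd (n₀ * n₁) := by
      exact_mod_cast divisorRank_inj (mul_ne_zero hn₀ hn₁)
        (by exact_mod_cast Nat.gcd_dvd_right _ _) (by exact_mod_cast Nat.gcd_dvd_right _ _) hg₁
    have h2 : d / d.gcd (n₀ * n₁) = d' / d'.gcd (n₀ * n₁) := by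
      exact_mod_cast divisorRank_inj (sub_ne_zero.2 hv) hd hd' hg₂
    obtain rfl : d = d' := by
      rw [← Nat.mul_div_cancel' (Nat.gcd_dvd_left d (n₀ * n₁)), h2, h1,
        Nat.mul_div_cancel' (Nat.gcd_dvd_left d' (n₀ * n₁))]
    simp only [residue] at hr hg₃ hn₂ hn₂'
    obtain rfl : n₂ = n₂' := by exact_mod_cast divisorRank_inj hr hn₂ hn₂' hg₃
    rfl
  · intro x hx
    exact wt_mul_b_le hR
  · simp only [Finset.card_product, Finset.card_range]
    push_cast
    rw [cast_card_sign]
    gcongr <;> first | exact card_posUpTo_le (by linarith) | exact card_absUpTo_le ‹_›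

/-- Lower triangular matrices with vanishing residue. -/
theorem sum_wt_le_of_b_eq_zero_of_residue (hK : DivisorCountLE K M) (hV : 1 ≤ V) (hN₀ : 1 ≤ N₀)
    (hN₂ : 1 ≤ N₂) (hT : 1 ≤ T) (S : Finset OrbitPoint)
    (hS : ∀ x ∈ S, Admissible D N₀ N₁ N₂ T V Z R x ∧ BoundedBy M x ∧ x.b = 0 ∧ x.c ≠ 0 ∧
      x.residue = 0) :
    ∑ x ∈ S, x.wt R ≤ (T * (N₀ * (N₂ * ((3 * V) * ((3 * V) * (2 * (K * K))))))) *
      (2 * symmHarmonic M) := by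
  have hL := one_le_symmHarmonic M
  have key : ∀ x ∈ S, x.v' - x.v ≠ 0 ∧ x.n₁ * (x.a * x.c) = x.v' - x.v := by
    intro x hx
    obtain ⟨h, -, hb, hc, hr⟩ := hS x hx
    obtain ⟨-, -, hn₁, -, -, -⟩ := h.ne_zero
    have ha := h.mul_eq_one_of_b hb
    have he := (eq_of_mul_eq_one ha).2
    rw [he] at ha
    have h1 : x.n₁ * (x.a * x.c) = x.v' - x.v := by
      rw [residue, hb, he] at hr
      linear_combination x.a * hr + (x.v' - x.v) * ha
    refine ⟨?_, h1⟩
    rw [← h1]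
    exact mul_ne_zero hn₁ (mul_ne_zero (left_ne_zero_of_mul_eq_one ha) hc)
  refine (sum_le_card_mul_symmHarmonic (M := M) (κ := 2) S (wt R)
    (posUpTo T ×ˢ posUpTo N₀ ×ˢ posUpTo N₂ ×ˢ absUpTo V ×ˢ absUpTo V ×ˢ ({1, -1} : Finset ℤ) ×ˢ
      Finset.range K ×ˢ Finset.range K)
    (fun x => (x.t, x.n₀, x.n₂, x.v, x.v', x.a, divisorRank (x.v' - x.v) x.n₁,
      divisorRank (x.n₀ * x.n₁ * x.n₂) x.d))
    (fun x => 0) (by positivity) ?_ ?_ ?_ ?_).trans ?_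
  · intro x hx
    simp only [Finset.mem_product, mem_posUpTo, mem_absUpTo]
    obtain ⟨h, hB, hb, hc, hr⟩ := hS x hx
    obtain ⟨-, -, -, -, -, hn⟩ := h.ne_zero
    exact ⟨⟨h.t_pos, h.t_le⟩, ⟨h.n₀_pos, h.n₀_le⟩, ⟨h.n₂_pos, h.n₂_le⟩, h.v_le, h.v'_le,
      (eq_of_mul_eq_one (h.mul_eq_one_of_b hb)).1,
      hK.mem_range (key x hx).1 hB.diff (Dvd.intro _ (key x hx).2),
      hK.mem_range hn hB.prod h.d_dvd_int⟩
  · intro x hx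
    simp
  · rintro ⟨t, n₀, n₁, n₂, d, v, v', a, b, c, e⟩ hx
      ⟨t', n₀', n₁', n₂', d', w, w', a', b', c', e'⟩ hy hg -
    obtain ⟨h, -, hb, -, -⟩ := hS _ hx
    obtain ⟨h', -, hb', -, -⟩ := hS _ hy
    obtain ⟨hv, hac⟩ := key _ hx
    obtain ⟨-, hac'⟩ := key _ hy
    obtain ⟨-, -, hn₁, -, -, hn⟩ := h.ne_zero
    have ha := h.mul_eq_one_of_b hb
    have he := (eq_of_mul_eq_one ha).2.symm
    have he' := (eq_of_mul_eq_one (h'.mul_eq_one_of_b hb')).2.symm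
    have hd := h.d_dvd_int
    have hd' := h'.d_dvd_int
    simp only [Prod.mk.injEq] at hg hb hb' hv hac hac' hn₁ hn ha he he' hd hd'
    obtain ⟨rfl, rfl, rfl, rfl, rfl, rfl, hg₁, hg₂⟩ := hg
    subst hb hb' he he'
    obtain rfl : n₁ = n₁' := by
      exact_mod_cast divisorRank_inj hv (Dvd.intro _ hac) (Dvd.intro _ hac') hg₁
    obtain rfl : d = d' := by exact_mod_cast divisorRank_inj hn hd hd' hg₂
    obtain rfl : c = c' := by
      refine mul_left_cancel₀ (mul_ne_zero hn₁ (left_ne_zero_of_mul_eq_one ha)) ?_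
      linear_combination hac - hac'
    rfl
  · intro x hx
    simpa using wt_le
  · simp only [Finset.card_product, Finset.card_range]
    push_cast
    rw [cast_card_sign]
    gcongr <;> first | exact card_posUpTo_le (by linarith) | exact card_absUpTo_le ‹_›

/-- Lower triangular matrices with nonzero residue. -/
theorem sum_wt_le_of_b_eq_zero_of_ne (hK : DivisorCountLE K M) (hV : 1 ≤ V) (hD : 1 ≤ D)
    (hR : 0 < R) (S : Finset OrbitPoint)
    (hS : ∀ x ∈ S, Admissible D N₀ N₁ N₂ T V Z R x ∧ BoundedBy M x ∧ x.b = 0 ∧ x.c ≠ 0 ∧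
      x.residue ≠ 0) :
    ∑ x ∈ S, x.wt R ≤ ((3 * V) * ((3 * V) * (2 * (K * (K * (K * (K * K))))))) *
      (2 * (D * R)⁻¹ * symmHarmonic M) := by
  have hL := one_le_symmHarmonic M
  refine (sum_le_card_mul_symmHarmonic (M := M) (κ := 2 * (D * R)⁻¹) S (wt R)
    (absUpTo V ×ˢ absUpTo V ×ˢ ({1, -1} : Finset ℤ) ×ˢ
      Finset.range K ×ˢ Finset.range K ×ˢ Finset.range K ×ˢ Finset.range K ×ˢ Finset.range K)
    (fun x => (x.v, x.v', x.a, divisorRank (x.t * x.n₀ * x.n₁ * x.c) x.t,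
      divisorRank (x.t * x.n₀ * x.n₁ * x.c) x.n₀, divisorRank (x.t * x.n₀ * x.n₁ * x.c) x.n₁,
      divisorRank x.residue x.n₂, divisorRank (x.n₀ * x.n₁ * x.n₂) x.d))
    (fun x => x.t * x.n₀ * x.n₁ * x.c) (by positivity) ?_ ?_ ?_ ?_).trans ?_
  · intro x hx
    simp only [Finset.mem_product, mem_absUpTo]
    obtain ⟨h, hB, hb, hc, hr⟩ := hS x hx
    obtain ⟨ht, hn₀, hn₁, -, -, hn⟩ := h.ne_zero
    have hy : (x.t * x.n₀ * x.n₁ * x.c : ℤ) ≠ 0 := by positivity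
    exact ⟨h.v_le, h.v'_le, (eq_of_mul_eq_one (h.mul_eq_one_of_b hb)).1,
      hK.mem_range hy hB.low ⟨x.n₀ * x.n₁ * x.c, by ring⟩,
      hK.mem_range hy hB.low ⟨x.t * x.n₁ * x.c, by ring⟩,
      hK.mem_range hy hB.low ⟨x.t * x.n₀ * x.c, by ring⟩,
      hK.mem_range hr hB.residue h.dvd, hK.mem_range hn hB.prod h.d_dvd_int⟩
  · exact fun x hx => (hS x hx).2.1.low
  · rintro ⟨t, n₀, n₁, n₂, d, v, v', a, b, c, e⟩ hx
      ⟨t', n₀', n₁', n₂', d', w, w', a', b', c', e'⟩ hy hg hf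
    obtain ⟨h, -, hb, hc, hr⟩ := hS _ hx
    obtain ⟨h', -, hb', -, -⟩ := hS _ hy
    obtain ⟨ht, hn₀, hn₁, -, -, hn⟩ := h.ne_zero
    have he := (eq_of_mul_eq_one (h.mul_eq_one_of_b hb)).2.symm
    have he' := (eq_of_mul_eq_one (h'.mul_eq_one_of_b hb')).2.symm
    have hd := h.d_dvd_int
    have hd' := h'.d_dvd_int
    have hn₂ := h.dvd
    have hn₂' := h'.dvd
    simp only [Prod.mk.injEq] at hg hf hb hb' hc ht hn₀ hn₁ hn he he' hd hd' hn₂ hn₂'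
    obtain ⟨rfl, rfl, rfl, hg₁, hg₂, hg₃, hg₄, hg₅⟩ := hg
    subst hb hb' he he'
    have hy0 : (t * n₀ * n₁ * c : ℤ) ≠ 0 := by positivity
    rw [← hf] at hg₁ hg₂ hg₃
    obtain rfl : t = t' := by
      exact_mod_cast divisorRank_inj hy0 ⟨n₀ * n₁ * c, by ring⟩
        ⟨n₀' * n₁' * c', by rw [hf]; ring⟩ hg₁
    obtain rfl : n₀ = n₀' := by
      exact_mod_cast divisorRank_inj hy0 ⟨t * n₁ * c, by ring⟩
        ⟨t * n₁' * c', by rw [hf]; ring⟩ hg₂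
    obtain rfl : n₁ = n₁' := by
      exact_mod_cast divisorRank_inj hy0 ⟨t * n₀ * c, by ring⟩
        ⟨t * n₀ * c', by rw [hf]; ring⟩ hg₃
    obtain rfl : c = c' := mul_left_cancel₀ (by positivity) hf
    simp only [residue, mul_zero, sub_zero] at hr hg₄ hn₂ hn₂'
    obtain rfl : n₂ = n₂' := by exact_mod_cast divisorRank_inj hr hn₂ hn₂' hg₄
    obtain rfl : d = d' := by exact_mod_cast divisorRank_inj hn hd hd' hg₅
    rfl
  · intro x hx
    obtain ⟨h, -, hb, hc, hr⟩ := hS x hx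
    obtain ⟨ht, hn₀, hn₁, -, -, hn⟩ := h.ne_zero
    have hy : (x.t * x.n₀ * x.n₁ * x.c : ℤ) ≠ 0 := by positivity
    have hmax : max 1 |((x.t * x.n₀ * x.n₁ * x.c : ℤ) : ℝ)|
        = |((x.t * x.n₀ * x.n₁ * x.c : ℤ) : ℝ)| :=
      max_eq_right (by exact_mod_cast Int.one_le_abs hy)
    rw [hmax, ← div_eq_mul_inv, le_div_iff₀ (by positivity)]
    refine le_trans ?_ (wt_mul_low_le (R := R) (x := x))
    have hlow : (x.d * x.n₀ * x.t ^ 2 * x.n₁ * x.c * R : ℝ)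
        = ((x.t * x.n₀ * x.n₁ * x.c : ℤ) : ℝ) * (x.d * x.t * R) := by push_cast; ring
    rw [hlow, abs_mul, mul_assoc]
    refine mul_le_mul_of_nonneg_left ?_ wt_nonneg
    refine mul_le_mul_of_nonneg_left ?_ (abs_nonneg _)
    refine le_trans ?_ (le_abs_self _)
    have h1 : (1 : ℝ) ≤ x.t := by exact_mod_cast h.t_pos
    have h2 := h.d_gt
    refine mul_le_mul_of_nonneg_right ?_ hR.le
    nlinarith
  · simp only [Finset.card_product, Finset.card_range]
    push_cast
    rw [cast_card_sign]
    gcongr <;> exact card_absUpTo_le ‹_›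

theorem Admissible.e_sq_le {x : OrbitPoint} (h : Admissible D N₀ N₁ N₂ T V Z R x) (hZ : 1 ≤ Z) :
    |(x.e : ℝ)| ≤ 3 * √Z := by
  have h1 := h.uSize_le
  have h2 := one_add_uSize R x
  have h3 : (x.e : ℝ) ^ 2 ≤ 3 ^ 2 * Z := by
    nlinarith [sq_nonneg (x.a : ℝ), sq_nonneg ((x.b : ℝ) / R),
      sq_nonneg ((x.d * x.n₀ * x.t ^ 2 * x.n₁ * x.c * R : ℝ))]
  refine (Real.abs_le_sqrt h3).trans_eq ?_
  rw [Real.sqrt_mul (by norm_num), Real.sqrt_sq (by norm_num)]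

/-- Matrices with `b c ≠ 0` and nonzero residue. -/
theorem sum_wt_le_of_ne_of_ne (hK : DivisorCountLE K M) (hV : 1 ≤ V) (hZ : 1 ≤ Z)
    (S : Finset OrbitPoint)
    (hS : ∀ x ∈ S, Admissible D N₀ N₁ N₂ T V Z R x ∧ BoundedBy M x ∧ x.b ≠ 0 ∧ x.c ≠ 0 ∧
      x.residue ≠ 0) :
    ∑ x ∈ S, x.wt R ≤ ((3 * V) * ((3 * V) * ((3 * (3 * √Z)) *
      (K * (K * (K * (K * (K * K)))))))) * (2 * symmHarmonic M) := by
  have hL := one_le_symmHarmonic M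
  have hZ' : 1 ≤ 3 * √Z := by linarith [Real.one_le_sqrt.2 hZ]
  refine (sum_le_card_mul_symmHarmonic (M := M) (κ := 2) S (wt R)
    (absUpTo V ×ˢ absUpTo V ×ˢ absUpTo (3 * √Z) ×ˢ Finset.range K ×ˢ Finset.range K ×ˢ
      Finset.range K ×ˢ Finset.range K ×ˢ Finset.range K ×ˢ Finset.range K)
    (fun x => (x.v, x.v', x.e, divisorRank (x.a * x.e - 1) x.d,
      divisorRank (x.a * x.e - 1) x.n₀, divisorRank (x.a * x.e - 1) x.t,
      divisorRank (x.a * x.e - 1) x.n₁, divisorRank (x.a * x.e - 1) x.c,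
      divisorRank x.residue x.n₂))
    (fun x => x.a) (by positivity) ?_ ?_ ?_ ?_).trans ?_
  · intro x hx
    simp only [Finset.mem_product, mem_absUpTo]
    obtain ⟨h, hB, hb, hc, hr⟩ := hS x hx
    have hy := h.diag_ne_zero hb hc
    have hq := h.diag_eq
    refine ⟨h.v_le, h.v'_le, h.e_sq_le hZ, hK.mem_range hy hB.diag ?_, hK.mem_range hy hB.diag ?_,
      hK.mem_range hy hB.diag ?_, hK.mem_range hy hB.diag ?_, hK.mem_range hy hB.diag ?_,
      hK.mem_range hr hB.residue h.dvd⟩ <;> rw [hq]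
    exacts [⟨x.b * x.n₀ * x.t ^ 2 * x.n₁ * x.c, by ring⟩,
      ⟨x.b * x.d * x.t ^ 2 * x.n₁ * x.c, by ring⟩,
      ⟨x.b * x.d * x.n₀ * x.t * x.n₁ * x.c, by ring⟩,
      ⟨x.b * x.d * x.n₀ * x.t ^ 2 * x.c, by ring⟩, ⟨x.b * x.d * x.n₀ * x.t ^ 2 * x.n₁, by ring⟩]
  · exact fun x hx => (hS x hx).2.1.a_le
  · rintro ⟨t, n₀, n₁, n₂, d, v, v', a, b, c, e⟩ hx
      ⟨t', n₀', n₁', n₂', d', w, w', a', b', c', e'⟩ hy hg hf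
    obtain ⟨h, -, hb, hc, hr⟩ := hS _ hx
    obtain ⟨h', -, -, -, -⟩ := hS _ hy
    obtain ⟨ht, hn₀, hn₁, -, hd, -⟩ := h.ne_zero
    have hy0 := h.diag_ne_zero hb hc
    have hq := h.diag_eq
    have hq' := h'.diag_eq
    have hn₂ := h.dvd
    have hn₂' := h'.dvd
    simp only [Prod.mk.injEq] at hg hf hb hc ht hn₀ hn₁ hd hy0 hq hq' hn₂ hn₂'
    obtain ⟨rfl, rfl, rfl, hg₁, hg₂, hg₃, hg₄, hg₅, hg₆⟩ := hg
    subst hf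
    obtain rfl : d = d' := by
      exact_mod_cast divisorRank_inj hy0 ⟨b * n₀ * t ^ 2 * n₁ * c, by rw [hq]; ring⟩
        ⟨b' * n₀' * t' ^ 2 * n₁' * c', by rw [hq']; ring⟩ hg₁
    obtain rfl : n₀ = n₀' := by
      exact_mod_cast divisorRank_inj hy0 ⟨b * d * t ^ 2 * n₁ * c, by rw [hq]; ring⟩
        ⟨b' * d * t' ^ 2 * n₁' * c', by rw [hq']; ring⟩ hg₂
    obtain rfl : t = t' := by
      exact_mod_cast divisorRank_inj hy0 ⟨b * d * n₀ * t * n₁ * c, by rw [hq]; ring⟩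
        ⟨b' * d * n₀ * t' * n₁' * c', by rw [hq']; ring⟩ hg₃
    obtain rfl : n₁ = n₁' := by
      exact_mod_cast divisorRank_inj hy0 ⟨b * d * n₀ * t ^ 2 * c, by rw [hq]; ring⟩
        ⟨b' * d * n₀ * t ^ 2 * c', by rw [hq']; ring⟩ hg₄
    obtain rfl : c = c' :=
      divisorRank_inj hy0 ⟨b * d * n₀ * t ^ 2 * n₁, by rw [hq]; ring⟩
        ⟨b' * d * n₀ * t ^ 2 * n₁, by rw [hq']; ring⟩ hg₅
    obtain rfl : b = b' := by
      refine mul_right_cancel₀ (b := (d * n₀ * t ^ 2 * n₁ * c : ℤ)) (by positivity) ?_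
      rw [← hq, ← hq']
    simp only [residue] at hr hg₆ hn₂ hn₂'
    obtain rfl : n₂ = n₂' := by exact_mod_cast divisorRank_inj hr hn₂ hn₂' hg₆
    rfl
  · exact fun x _ => wt_mul_a_le
  · simp only [Finset.card_product, Finset.card_range]
    push_cast
    gcongr <;> exact card_absUpTo_le ‹_›

/-- Matrices with `b c ≠ 0`, vanishing residue and `v ≠ 0`. -/
theorem sum_wt_le_of_residue_of_v (hK : DivisorCountLE K M) (hV : 1 ≤ V) (hN₂ : 1 ≤ N₂)
    (S : Finset OrbitPoint)
    (hS : ∀ x ∈ S, Admissible D N₀ N₁ N₂ T V Z R x ∧ BoundedBy M x ∧ x.b ≠ 0 ∧ x.c ≠ 0 ∧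
      x.residue = 0 ∧ x.v ≠ 0) :
    ∑ x ∈ S, x.wt R ≤ ((3 * V) * (N₂ * (2 *
      (K * (K * (K * (K * (K * K)))))))) * (2 * symmHarmonic M) := by
  have hL := one_le_symmHarmonic M
  set η : OrbitPoint → ℤ := fun x => x.a + x.d * x.n₀ * x.t ^ 2 * x.b * x.v with hη
  refine (sum_le_card_mul_symmHarmonic (M := M) (κ := 2) S (wt R)
    (absUpTo V ×ˢ posUpTo N₂ ×ˢ ({1, -1} : Finset ℤ) ×ˢ Finset.range K ×ˢ Finset.range K ×ˢ
      Finset.range K ×ˢ Finset.range K ×ˢ Finset.range K ×ˢ Finset.range K)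
    (fun x => (x.v', x.n₂, η x, divisorRank (x.a - η x) x.d,
      divisorRank (x.a - η x) x.n₀, divisorRank (x.a - η x) x.t,
      divisorRank (x.a - η x) x.b, divisorRank (x.a - η x) x.v,
      divisorRank (x.a * x.e - 1) x.n₁))
    (fun x => x.a) (by positivity) ?_ ?_ ?_ ?_).trans ?_
  · intro x hx
    simp only [Finset.mem_product, mem_posUpTo, mem_absUpTo]
    obtain ⟨h, hB, hb, hc, hr, hv⟩ := hS x hx
    obtain ⟨ht, hn₀, hn₁, -, hd, -⟩ := h.ne_zero
    have hη1 := (eq_of_mul_eq_one (h.mul_eq_one_of_residue hr)).1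
    have hy0 : x.a - η x = -(x.d * x.n₀ * x.t ^ 2 * x.b * x.v) := by rw [hη]; ring
    have hy : x.a - η x ≠ 0 := by rw [hy0]; exact neg_ne_zero.2 (by positivity)
    have hM := hB.a_sub (η x) (by simpa using hη1)
    refine ⟨h.v'_le, ⟨h.n₂_pos, h.n₂_le⟩, hη1, hK.mem_range hy hM ?_, hK.mem_range hy hM ?_,
      hK.mem_range hy hM ?_, hK.mem_range hy hM ?_, hK.mem_range hy hM ?_,
      hK.mem_range (h.diag_ne_zero hb hc) hB.diag ⟨x.b * x.d * x.n₀ * x.t ^ 2 * x.c, by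
        rw [h.diag_eq]; ring⟩⟩ <;> rw [hy0]
    exacts [⟨-(x.n₀ * x.t ^ 2 * x.b * x.v), by ring⟩, ⟨-(x.d * x.t ^ 2 * x.b * x.v), by ring⟩,
      ⟨-(x.d * x.n₀ * x.t * x.b * x.v), by ring⟩, ⟨-(x.d * x.n₀ * x.t ^ 2 * x.v), by ring⟩,
      ⟨-(x.d * x.n₀ * x.t ^ 2 * x.b), by ring⟩]
  · exact fun x hx => (hS x hx).2.1.a_le
  · rintro ⟨t, n₀, n₁, n₂, d, v, v', a, b, c, e⟩ hx
      ⟨t', n₀', n₁', n₂', d', w, w', a', b', c', e'⟩ hy hg hf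
    obtain ⟨h, -, hb, hc, hr, hv⟩ := hS _ hx
    obtain ⟨h', -, -, -, hr', -⟩ := hS _ hy
    obtain ⟨ht, hn₀, hn₁, -, hd, -⟩ := h.ne_zero
    have hy0 := h.diag_ne_zero hb hc
    have hq := h.diag_eq
    have hq' := h'.diag_eq
    have hu := (eq_of_mul_eq_one (h.mul_eq_one_of_residue hr)).2
    have hu' := (eq_of_mul_eq_one (h'.mul_eq_one_of_residue hr')).2
    simp only [hη, Prod.mk.injEq] at hg hf hb hc hv ht hn₀ hn₁ hd hy0 hq hq' hu hu'
    obtain ⟨rfl, rfl, hg₀, hg₁, hg₂, hg₃, hg₄, hg₅, hg₆⟩ := hg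
    subst hf
    rw [← hg₀] at hg₁ hg₂ hg₃ hg₄ hg₅ hu'
    set u : ℤ := a + d * n₀ * t ^ 2 * b * v with hudef
    have hy1 : a - u = -(d * n₀ * t ^ 2 * b * v) := by rw [hudef]; ring
    have hy1' : a - u = -(d' * n₀' * t' ^ 2 * b' * w) := by rw [hg₀]; ring
    have hy1_ne : a - u ≠ 0 := by rw [hy1]; exact neg_ne_zero.2 (by positivity)
    obtain rfl : d = d' := by
      exact_mod_cast divisorRank_inj hy1_ne ⟨-(n₀ * t ^ 2 * b * v), by rw [hy1]; ring⟩
        ⟨-(n₀' * t' ^ 2 * b' * w), by rw [hy1']; ring⟩ hg₁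
    obtain rfl : n₀ = n₀' := by
      exact_mod_cast divisorRank_inj hy1_ne ⟨-(d * t ^ 2 * b * v), by rw [hy1]; ring⟩
        ⟨-(d * t' ^ 2 * b' * w), by rw [hy1']; ring⟩ hg₂
    obtain rfl : t = t' := by
      exact_mod_cast divisorRank_inj hy1_ne ⟨-(d * n₀ * t * b * v), by rw [hy1]; ring⟩
        ⟨-(d * n₀ * t' * b' * w), by rw [hy1']; ring⟩ hg₃
    obtain rfl : b = b' :=
      divisorRank_inj hy1_ne ⟨-(d * n₀ * t ^ 2 * v), by rw [hy1]; ring⟩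
        ⟨-(d * n₀ * t ^ 2 * w), by rw [hy1']; ring⟩ hg₄
    obtain rfl : v = w :=
      divisorRank_inj hy1_ne ⟨-(d * n₀ * t ^ 2 * b), by rw [hy1]; ring⟩
        ⟨-(d * n₀ * t ^ 2 * b), by rw [hy1']; ring⟩ hg₅
    obtain rfl : e = e' := by linear_combination hu - hu'
    obtain rfl : n₁ = n₁' := by
      exact_mod_cast divisorRank_inj hy0 ⟨b * d * n₀ * t ^ 2 * c, by rw [hq]; ring⟩
        ⟨b * d * n₀ * t ^ 2 * c', by rw [hq']; ring⟩ hg₆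
    obtain rfl : c = c' := by
      refine mul_left_cancel₀ (a := (b * d * n₀ * t ^ 2 * n₁ : ℤ)) (by positivity) ?_
      linear_combination hq' - hq
    rfl
  · exact fun x _ => wt_mul_a_le
  · simp only [Finset.card_product, Finset.card_range]
    push_cast
    rw [cast_card_sign]
    gcongr <;> first | exact card_posUpTo_le (by linarith) | exact card_absUpTo_le ‹_›

/-- Matrices with `b c ≠ 0`, vanishing residue and `v' ≠ 0`. -/
theorem sum_wt_le_of_residue_of_v' (hK : DivisorCountLE K M) (hV : 1 ≤ V) (hN₂ : 1 ≤ N₂)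
    (S : Finset OrbitPoint)
    (hS : ∀ x ∈ S, Admissible D N₀ N₁ N₂ T V Z R x ∧ BoundedBy M x ∧ x.b ≠ 0 ∧ x.c ≠ 0 ∧
      x.residue = 0 ∧ x.v' ≠ 0) :
    ∑ x ∈ S, x.wt R ≤ ((3 * V) * (N₂ * (2 *
      (K * (K * (K * (K * (K * K)))))))) * (2 * symmHarmonic M) := by
  have hL := one_le_symmHarmonic M
  set η : OrbitPoint → ℤ := fun x => x.e - x.d * x.n₀ * x.t ^ 2 * x.b * x.v' with hη
  refine (sum_le_card_mul_symmHarmonic (M := M) (κ := 2) S (wt R)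
    (absUpTo V ×ˢ posUpTo N₂ ×ˢ ({1, -1} : Finset ℤ) ×ˢ Finset.range K ×ˢ Finset.range K ×ˢ
      Finset.range K ×ˢ Finset.range K ×ˢ Finset.range K ×ˢ Finset.range K)
    (fun x => (x.v, x.n₂, η x, divisorRank (x.e - η x) x.d,
      divisorRank (x.e - η x) x.n₀, divisorRank (x.e - η x) x.t,
      divisorRank (x.e - η x) x.b, divisorRank (x.e - η x) x.v',
      divisorRank (x.a * x.e - 1) x.n₁))
    (fun x => x.e) (by positivity) ?_ ?_ ?_ ?_).trans ?_
  · intro x hx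
    simp only [Finset.mem_product, mem_posUpTo, mem_absUpTo]
    obtain ⟨h, hB, hb, hc, hr, hv⟩ := hS x hx
    obtain ⟨ht, hn₀, hn₁, -, hd, -⟩ := h.ne_zero
    obtain ⟨hη1, hη2⟩ := eq_of_mul_eq_one (h.mul_eq_one_of_residue hr)
    rw [← hη2] at hη1
    have hy0 : x.e - η x = x.d * x.n₀ * x.t ^ 2 * x.b * x.v' := by rw [hη]; ring
    have hy : x.e - η x ≠ 0 := by rw [hy0]; positivity
    have hM := hB.e_sub (η x) (by simpa using hη1)
    refine ⟨h.v_le, ⟨h.n₂_pos, h.n₂_le⟩, hη1, hK.mem_range hy hM ?_, hK.mem_range hy hM ?_,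
      hK.mem_range hy hM ?_, hK.mem_range hy hM ?_, hK.mem_range hy hM ?_,
      hK.mem_range (h.diag_ne_zero hb hc) hB.diag ⟨x.b * x.d * x.n₀ * x.t ^ 2 * x.c, by
        rw [h.diag_eq]; ring⟩⟩ <;> rw [hy0]
    exacts [⟨x.n₀ * x.t ^ 2 * x.b * x.v', by ring⟩, ⟨x.d * x.t ^ 2 * x.b * x.v', by ring⟩,
      ⟨x.d * x.n₀ * x.t * x.b * x.v', by ring⟩, ⟨x.d * x.n₀ * x.t ^ 2 * x.v', by ring⟩,
      ⟨x.d * x.n₀ * x.t ^ 2 * x.b, by ring⟩]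
  · exact fun x hx => (hS x hx).2.1.e_le
  · rintro ⟨t, n₀, n₁, n₂, d, v, v', a, b, c, e⟩ hx
      ⟨t', n₀', n₁', n₂', d', w, w', a', b', c', e'⟩ hy hg hf
    obtain ⟨h, -, hb, hc, hr, hv⟩ := hS _ hx
    obtain ⟨h', -, -, -, hr', -⟩ := hS _ hy
    obtain ⟨ht, hn₀, hn₁, -, hd, -⟩ := h.ne_zero
    have hy0 := h.diag_ne_zero hb hc
    have hq := h.diag_eq
    have hq' := h'.diag_eq
    have hu := (eq_of_mul_eq_one (h.mul_eq_one_of_residue hr)).2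
    have hu' := (eq_of_mul_eq_one (h'.mul_eq_one_of_residue hr')).2
    simp only [hη, Prod.mk.injEq] at hg hf hb hc hv ht hn₀ hn₁ hd hy0 hq hq' hu hu'
    obtain ⟨rfl, rfl, hg₀, hg₁, hg₂, hg₃, hg₄, hg₅, hg₆⟩ := hg
    subst hf
    rw [← hg₀] at hg₁ hg₂ hg₃ hg₄ hg₅ hu'
    set u : ℤ := e - d * n₀ * t ^ 2 * b * v' with hudef
    have hy1 : e - u = d * n₀ * t ^ 2 * b * v' := by rw [hudef]; ring
    have hy1' : e - u = d' * n₀' * t' ^ 2 * b' * w' := by rw [hg₀]; ring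
    have hy1_ne : e - u ≠ 0 := by rw [hy1]; positivity
    obtain rfl : d = d' := by
      exact_mod_cast divisorRank_inj hy1_ne ⟨n₀ * t ^ 2 * b * v', by rw [hy1]; ring⟩
        ⟨n₀' * t' ^ 2 * b' * w', by rw [hy1']; ring⟩ hg₁
    obtain rfl : n₀ = n₀' := by
      exact_mod_cast divisorRank_inj hy1_ne ⟨d * t ^ 2 * b * v', by rw [hy1]; ring⟩
        ⟨d * t' ^ 2 * b' * w', by rw [hy1']; ring⟩ hg₂
    obtain rfl : t = t' := by
      exact_mod_cast divisorRank_inj hy1_ne ⟨d * n₀ * t * b * v', by rw [hy1]; ring⟩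
        ⟨d * n₀ * t' * b' * w', by rw [hy1']; ring⟩ hg₃
    obtain rfl : b = b' :=
      divisorRank_inj hy1_ne ⟨d * n₀ * t ^ 2 * v', by rw [hy1]; ring⟩
        ⟨d * n₀ * t ^ 2 * w', by rw [hy1']; ring⟩ hg₄
    obtain rfl : v' = w' :=
      divisorRank_inj hy1_ne ⟨d * n₀ * t ^ 2 * b, by rw [hy1]; ring⟩
        ⟨d * n₀ * t ^ 2 * b, by rw [hy1']; ring⟩ hg₅
    obtain rfl : a = a' := by linear_combination hu' - hu
    obtain rfl : n₁ = n₁' := by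
      exact_mod_cast divisorRank_inj hy0 ⟨b * d * n₀ * t ^ 2 * c, by rw [hq]; ring⟩
        ⟨b * d * n₀ * t ^ 2 * c', by rw [hq']; ring⟩ hg₆
    obtain rfl : c = c' := by
      refine mul_left_cancel₀ (a := (b * d * n₀ * t ^ 2 * n₁ : ℤ)) (by positivity) ?_
      linear_combination hq' - hq
    rfl
  · exact fun x _ => wt_mul_e_le
  · simp only [Finset.card_product, Finset.card_range]
    push_cast
    rw [cast_card_sign]
    gcongr <;> first | exact card_posUpTo_le (by linarith) | exact card_absUpTo_le ‹_›

theorem sum_wt_le (hK : DivisorCountLE K M) (hK1 : 1 ≤ K) (hD : 1 ≤ D) (hN₀ : 1 ≤ N₀)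
    (hN₁ : 1 ≤ N₁) (hN₂ : 1 ≤ N₂) (hT : 1 ≤ T) (hV : 1 ≤ V) (hZ : 1 ≤ Z) (hR : 0 < R)
    (S : Finset OrbitPoint)
    (hS : ∀ x ∈ S, Admissible D N₀ N₁ N₂ T V Z R x ∧ BoundedBy M x) :
    ∑ x ∈ S, x.wt R ≤ 318 * ((K : ℝ) ^ 6 * symmHarmonic M *
      (N₀ * T * V * (1 + R) * (N₁ * N₂ + N₁ * V + N₂ * V) + V ^ 2 * ((D * R)⁻¹ + √Z))) := by
  have hL := one_le_symmHarmonic M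
  have hK' : (1 : ℝ) ≤ K := by exact_mod_cast hK1
  set X := N₀ * T * V * (1 + R) * (N₁ * N₂ + N₁ * V + N₂ * V) + V ^ 2 * ((D * R)⁻¹ + √Z) with hX
  have hsplit : ∑ x ∈ S, x.wt R ≤
      ∑ x ∈ S with x.c = 0 ∧ x.v = x.v', x.wt R
      + ∑ x ∈ S with x.c = 0 ∧ x.residue = 0, x.wt R
      + ∑ x ∈ S with x.c = 0 ∧ x.v' ≠ x.v ∧ x.residue ≠ 0, x.wt R
      + ∑ x ∈ S with x.b = 0 ∧ x.c ≠ 0 ∧ x.residue = 0, x.wt R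
      + ∑ x ∈ S with x.b = 0 ∧ x.c ≠ 0 ∧ x.residue ≠ 0, x.wt R
      + ∑ x ∈ S with x.b ≠ 0 ∧ x.c ≠ 0 ∧ x.residue ≠ 0, x.wt R
      + ∑ x ∈ S with x.b ≠ 0 ∧ x.c ≠ 0 ∧ x.residue = 0 ∧ x.v ≠ 0, x.wt R
      + ∑ x ∈ S with x.b ≠ 0 ∧ x.c ≠ 0 ∧ x.residue = 0 ∧ x.v' ≠ 0, x.wt R := by
    simp only [Finset.sum_filter, ← Finset.sum_add_distrib]
    refine Finset.sum_le_sum fun x hx => ?_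
    have h0 : 0 ≤ x.wt R := wt_nonneg
    have hi : ∀ (p : Prop) [Decidable p], 0 ≤ if p then x.wt R else 0 := fun p _ => by
      split_ifs <;> simp [h0]
    have hcover : (x.c = 0 ∧ x.v = x.v') ∨ (x.c = 0 ∧ x.residue = 0) ∨
        (x.c = 0 ∧ x.v' ≠ x.v ∧ x.residue ≠ 0) ∨ (x.b = 0 ∧ x.c ≠ 0 ∧ x.residue = 0) ∨
        (x.b = 0 ∧ x.c ≠ 0 ∧ x.residue ≠ 0) ∨ (x.b ≠ 0 ∧ x.c ≠ 0 ∧ x.residue ≠ 0) ∨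
        (x.b ≠ 0 ∧ x.c ≠ 0 ∧ x.residue = 0 ∧ x.v ≠ 0) ∨
        (x.b ≠ 0 ∧ x.c ≠ 0 ∧ x.residue = 0 ∧ x.v' ≠ 0) := by
      rcases em (x.c = 0) with hc | hc
      · rcases em (x.v = x.v') with hv | hv
        · exact Or.inl ⟨hc, hv⟩
        rcases em (x.residue = 0) with hr | hr
        · exact Or.inr (Or.inl ⟨hc, hr⟩)
        · exact Or.inr (Or.inr (Or.inl ⟨hc, Ne.symm hv, hr⟩))
      refine Or.inr (Or.inr (Or.inr ?_))
      rcases em (x.b = 0) with hb | hb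
      · rcases em (x.residue = 0) with hr | hr
        · exact Or.inl ⟨hb, hc, hr⟩
        · exact Or.inr (Or.inl ⟨hb, hc, hr⟩)
      refine Or.inr (Or.inr ?_)
      rcases em (x.residue = 0) with hr | hr
      · rcases em (x.v = 0) with hv | hv
        · refine Or.inr (Or.inr ⟨hb, hc, hr, fun hv' => ?_⟩)
          obtain ⟨-, -, hn₁, -, -, -⟩ := (hS x hx).1.ne_zero
          rw [residue, hv, hv'] at hr
          exact mul_ne_zero hn₁ hc (by linear_combination hr)
        · exact Or.inr (Or.inl ⟨hb, hc, hr, hv⟩)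
      · exact Or.inl ⟨hb, hc, hr⟩
    have e1 := hi (x.c = 0 ∧ x.v = x.v')
    have e2 := hi (x.c = 0 ∧ x.residue = 0)
    have e3 := hi (x.c = 0 ∧ x.v' ≠ x.v ∧ x.residue ≠ 0)
    have e4 := hi (x.b = 0 ∧ x.c ≠ 0 ∧ x.residue = 0)
    have e5 := hi (x.b = 0 ∧ x.c ≠ 0 ∧ x.residue ≠ 0)
    have e6 := hi (x.b ≠ 0 ∧ x.c ≠ 0 ∧ x.residue ≠ 0)
    have e7 := hi (x.b ≠ 0 ∧ x.c ≠ 0 ∧ x.residue = 0 ∧ x.v ≠ 0)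
    have e8 := hi (x.b ≠ 0 ∧ x.c ≠ 0 ∧ x.residue = 0 ∧ x.v' ≠ 0)
    rcases hcover with h | h | h | h | h | h | h | h
    · rw [if_pos h] at e1 ⊢; linarith
    · rw [if_pos h] at e2 ⊢; linarith
    · rw [if_pos h] at e3 ⊢; linarith
    · rw [if_pos h] at e4 ⊢; linarith
    · rw [if_pos h] at e5 ⊢; linarith
    · rw [if_pos h] at e6 ⊢; linarith
    · rw [if_pos h] at e7 ⊢; linarith
    · rw [if_pos h] at e8 ⊢; linarith
  have hfilter : ∀ (p : OrbitPoint → Prop) [DecidablePred p], ∀ x ∈ S.filter p,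
      Admissible D N₀ N₁ N₂ T V Z R x ∧ BoundedBy M x ∧ p x := fun p _ x hx =>
    have h := Finset.mem_filter.1 hx
    ⟨(hS x h.1).1, (hS x h.1).2, h.2⟩
  have hDR : 0 ≤ (D * R)⁻¹ := by positivity
  have hcombine : ∀ (j : ℕ) (p : ℝ), j ≤ 6 → p ≤ X →
      (K : ℝ) ^ j * symmHarmonic M * p ≤ (K : ℝ) ^ 6 * symmHarmonic M * X := by
    intro j p hj hp
    have hX0 : 0 ≤ X := by positivity
    calc (K : ℝ) ^ j * symmHarmonic M * p ≤ (K : ℝ) ^ j * symmHarmonic M * X := by gcongr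
      _ ≤ _ := by gcongr
  have q1 : N₀ * T * V * (1 + R) * (N₁ * N₂) ≤ X := by
    have : 0 ≤ N₀ * T * V * (1 + R) * (N₁ * V + N₂ * V) + V ^ 2 * ((D * R)⁻¹ + √Z) := by positivity
    linarith
  have q2 : N₀ * T * V * (1 + R) * (N₁ * V) ≤ X := by
    have : 0 ≤ N₀ * T * V * (1 + R) * (N₁ * N₂ + N₂ * V) + V ^ 2 * ((D * R)⁻¹ + √Z) := by
      positivity
    linarith
  have q3 : N₀ * T * V * 1 * (N₂ * V) ≤ X := by
    have : 0 ≤ N₀ * T * V * (1 + R) * (N₁ * N₂ + N₁ * V) + V ^ 2 * ((D * R)⁻¹ + √Z)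
      + N₀ * T * V * R * (N₂ * V) := by positivity
    linarith
  have q4 : V ^ 2 * (D * R)⁻¹ ≤ X := by
    have : 0 ≤ N₀ * T * V * (1 + R) * (N₁ * N₂ + N₁ * V + N₂ * V) + V ^ 2 * √Z := by positivity
    linarith
  have q5 : V ^ 2 * √Z ≤ X := by
    have : 0 ≤ N₀ * T * V * (1 + R) * (N₁ * N₂ + N₁ * V + N₂ * V) + V ^ 2 * (D * R)⁻¹ := by
      positivity
    linarith
  have q6 : 1 * 1 * 1 * 1 * (N₂ * V) ≤ X := le_trans (by gcongr) q3
  have b1 := sum_wt_le_of_c_eq_zero_of_eq hK hV hN₀ hN₁ hN₂ hT hR _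
    (hfilter fun x => x.c = 0 ∧ x.v = x.v')
  have b2 := sum_wt_le_of_c_eq_zero_of_residue hK hV hN₀ hN₁ hN₂ hT hR _
    (hfilter fun x => x.c = 0 ∧ x.residue = 0)
  have b3 := sum_wt_le_of_c_eq_zero_of_ne hK hV hN₀ hN₁ hT hR _
    (hfilter fun x => x.c = 0 ∧ x.v' ≠ x.v ∧ x.residue ≠ 0)
  have b4 := sum_wt_le_of_b_eq_zero_of_residue hK hV hN₀ hN₂ hT _
    (hfilter fun x => x.b = 0 ∧ x.c ≠ 0 ∧ x.residue = 0)
  have b5 := sum_wt_le_of_b_eq_zero_of_ne hK hV hD hR _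
    (hfilter fun x => x.b = 0 ∧ x.c ≠ 0 ∧ x.residue ≠ 0)
  have b6 := sum_wt_le_of_ne_of_ne hK hV hZ _
    (hfilter fun x => x.b ≠ 0 ∧ x.c ≠ 0 ∧ x.residue ≠ 0)
  have b7 := sum_wt_le_of_residue_of_v hK hV hN₂ _
    (hfilter fun x => x.b ≠ 0 ∧ x.c ≠ 0 ∧ x.residue = 0 ∧ x.v ≠ 0)
  have b8 := sum_wt_le_of_residue_of_v' hK hV hN₂ _
    (hfilter fun x => x.b ≠ 0 ∧ x.c ≠ 0 ∧ x.residue = 0 ∧ x.v' ≠ 0)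
  have r1 := hcombine 1 _ (by norm_num) q1
  have r2 := hcombine 3 _ (by norm_num) q2
  have r3 := hcombine 2 _ (by norm_num) q3
  have r4 := hcombine 5 _ (by norm_num) q4
  have r5 := hcombine 6 _ (by norm_num) q5
  have r6 := hcombine 6 _ (by norm_num) q6
  clear_value X
  linarith

theorem abs_le_floor_of_abs_cast_le {n : ℤ} {y : ℝ} (h : |(n : ℝ)| ≤ y) :
    |n| ≤ (⌊y⌋₊ : ℤ) := by
  have h1 : n.natAbs ≤ ⌊y⌋₊ := Nat.le_floor (by rw [Nat.cast_natAbs]; exact_mod_cast h)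
  rw [Int.abs_eq_natAbs]
  exact_mod_cast h1

theorem Admissible.boundedBy {Q : ℝ} {x : OrbitPoint} (h : Admissible D N₀ N₁ N₂ T V Z R x)
    (hR : 0 < R) (hQ : 1 ≤ Q) (hN₀ : N₀ ≤ Q) (hN₁ : N₁ ≤ Q) (hN₂ : N₂ ≤ Q) (hT : T ≤ Q)
    (hV : V ≤ Q) (hZ : Z ≤ Q) (hRQ : R ≤ Q) (hRQ' : R⁻¹ ≤ Q) : BoundedBy ⌊12 * Q ^ 10⌋₊ x := by
  have hQ0 : 0 ≤ Q := by linarith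
  have hu := one_add_uSize R x
  have hu' := h.uSize_le
  have hpow : ∀ k : ℕ, k ≤ 10 → Q ^ k ≤ Q ^ 10 := fun k hk => pow_le_pow_right₀ hQ hk
  have p0 := hpow 0 (by norm_num)
  have p1 := hpow 1 (by norm_num)
  have p2 := hpow 2 (by norm_num)
  have p3 := hpow 3 (by norm_num)
  rw [pow_zero] at p0
  rw [pow_one] at p1
  have hsq : ∀ y : ℝ, y ^ 2 ≤ 4 * (1 + uSize R x.mat) → |y| ≤ 3 * Q := by
    intro y hy
    refine abs_le_of_sq_le_sq (by nlinarith) (by positivity)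
  have ha : |(x.a : ℝ)| ≤ 3 * Q := by
    refine hsq _ ?_
    rw [hu]
    nlinarith [sq_nonneg ((x.b : ℝ) / R), sq_nonneg (x.e : ℝ),
      sq_nonneg ((x.d * x.n₀ * x.t ^ 2 * x.n₁ * x.c * R : ℝ))]
  have he : |(x.e : ℝ)| ≤ 3 * Q := by
    refine hsq _ ?_
    rw [hu]
    nlinarith [sq_nonneg ((x.b : ℝ) / R), sq_nonneg (x.a : ℝ),
      sq_nonneg ((x.d * x.n₀ * x.t ^ 2 * x.n₁ * x.c * R : ℝ))]
  have hb : |(x.b : ℝ)| ≤ 3 * Q ^ 2 := by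
    have h1 : |(x.b : ℝ) / R| ≤ 3 * Q := by
      refine hsq _ ?_
      rw [hu]
      nlinarith [sq_nonneg (x.a : ℝ), sq_nonneg (x.e : ℝ),
        sq_nonneg ((x.d * x.n₀ * x.t ^ 2 * x.n₁ * x.c * R : ℝ))]
    rw [abs_div, abs_of_pos hR, div_le_iff₀ hR] at h1
    calc |(x.b : ℝ)| ≤ 3 * Q * R := h1
      _ ≤ 3 * Q * Q := by gcongr
      _ = _ := by ring
  have hC : |(x.d * x.n₀ * x.t ^ 2 * x.n₁ * x.c : ℝ)| ≤ 3 * Q ^ 2 := by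
    have h1 : |(x.d * x.n₀ * x.t ^ 2 * x.n₁ * x.c * R : ℝ)| ≤ 3 * Q := by
      refine hsq _ ?_
      rw [hu]
      nlinarith [sq_nonneg (x.a : ℝ), sq_nonneg (x.e : ℝ), sq_nonneg ((x.b : ℝ) / R)]
    rw [abs_mul, abs_of_pos hR] at h1
    calc _ = |(x.d * x.n₀ * x.t ^ 2 * x.n₁ * x.c : ℝ)| * R * R⁻¹ := by field_simp
      _ ≤ 3 * Q * R⁻¹ := by gcongr
      _ ≤ 3 * Q * Q := by gcongr
      _ = _ := by ring
  obtain ⟨-, -, -, -, hd0, -⟩ := h.ne_zero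
  have ht1 : (1 : ℝ) ≤ x.t := by exact_mod_cast h.t_pos
  have hn₀1 : (1 : ℝ) ≤ x.n₀ := by exact_mod_cast h.n₀_pos
  have hd1 : (1 : ℝ) ≤ x.d := by exact_mod_cast (show 1 ≤ x.d by omega)
  have hn₀Q := h.n₀_le.trans hN₀
  have hn₁Q := h.n₁_le.trans hN₁
  have hn₂Q := h.n₂_le.trans hN₂
  have htQ := h.t_le.trans hT
  have hvQ := h.v_le.trans hV
  have hv'Q := h.v'_le.trans hV
  have hnQ : (x.n₀ * x.n₁ * x.n₂ : ℝ) ≤ Q ^ 3 := by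
    calc (x.n₀ * x.n₁ * x.n₂ : ℝ) ≤ Q * Q * Q := by gcongr
      _ = _ := by ring
  have hnQ' : (x.n₀ * x.n₁ : ℝ) ≤ Q ^ 2 := by
    calc (x.n₀ * x.n₁ : ℝ) ≤ Q * Q := by gcongr
      _ = _ := by ring
  have hdQ : (x.d : ℝ) ≤ Q ^ 3 := by
    refine le_trans ?_ hnQ
    have := h.n₀_pos; have := h.n₁_pos; have := h.n₂_pos
    exact_mod_cast Nat.le_of_dvd (by positivity) h.d_dvd
  have hlow : |(x.t * x.n₀ * x.n₁ * x.c : ℝ)| ≤ 3 * Q ^ 2 := by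
    refine le_trans ?_ hC
    have h1 : (x.d * x.n₀ * x.t ^ 2 * x.n₁ * x.c : ℝ)
        = (x.d * x.t) * (x.t * x.n₀ * x.n₁ * x.c) := by ring
    rw [h1, abs_mul _ (x.t * x.n₀ * x.n₁ * x.c : ℝ)]
    refine le_mul_of_one_le_left (abs_nonneg _) ((one_le_mul_of_one_le_of_one_le hd1 ht1).trans ?_)
    exact le_abs_self _
  have hnc : |(x.n₁ * x.c : ℝ)| ≤ 3 * Q ^ 2 := by
    refine le_trans ?_ hlow
    have h1 : (x.t * x.n₀ * x.n₁ * x.c : ℝ) = (x.t * x.n₀) * (x.n₁ * x.c) := by ring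
    rw [h1, abs_mul _ (x.n₁ * x.c : ℝ)]
    refine le_mul_of_one_le_left (abs_nonneg _) ((one_le_mul_of_one_le_of_one_le ht1 hn₀1).trans ?_)
    exact le_abs_self _
  refine ⟨?_, ?_, ?_, ?_, ?_, ?_, ?_, ?_, ?_, ?_, ?_⟩
  · refine abs_le_floor_of_abs_cast_le ?_
    push_cast
    rw [abs_of_nonneg (by positivity)]
    linarith
  · refine abs_le_floor_of_abs_cast_le ?_
    push_cast
    rw [abs_of_nonneg (by positivity)]
    linarith
  · refine abs_le_floor_of_abs_cast_le ?_
    rw [residue]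
    push_cast
    have h1 : |(x.v' * x.a : ℝ)| ≤ 3 * Q ^ 2 := by
      rw [abs_mul]
      calc _ ≤ Q * (3 * Q) := by gcongr
        _ = _ := by ring
    have h2 : |(x.v * x.e : ℝ)| ≤ 3 * Q ^ 2 := by
      rw [abs_mul]
      calc _ ≤ Q * (3 * Q) := by gcongr
        _ = _ := by ring
    have h3 : |(x.d * x.n₀ * x.t ^ 2 * x.v * x.v' * x.b : ℝ)| ≤ 3 * Q ^ 10 := by
      rw [abs_mul, abs_mul, abs_mul, abs_of_nonneg (by positivity)]
      calc _ ≤ Q ^ 3 * Q * Q ^ 2 * Q * Q * (3 * Q ^ 2) := by gcongr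
        _ = _ := by ring
    have h4 := abs_sub (x.n₁ * x.c - x.v' * x.a + x.v * x.e : ℝ)
      (x.d * x.n₀ * x.t ^ 2 * x.v * x.v' * x.b)
    have h5 := abs_add_le (x.n₁ * x.c - x.v' * x.a : ℝ) (x.v * x.e)
    have h6 := abs_sub (x.n₁ * x.c : ℝ) (x.v' * x.a)
    linarith
  · refine abs_le_floor_of_abs_cast_le ?_
    push_cast
    have h1 : |(x.a * x.e : ℝ)| ≤ 9 * Q ^ 2 := by
      rw [abs_mul]
      calc _ ≤ (3 * Q) * (3 * Q) := by gcongr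
        _ = _ := by ring
    have h2 := abs_sub (x.a * x.e : ℝ) 1
    rw [abs_one] at h2
    linarith
  · refine abs_le_floor_of_abs_cast_le ?_
    push_cast
    linarith [abs_sub (x.v' : ℝ) x.v]
  · exact abs_le_floor_of_abs_cast_le (by linarith)
  · exact abs_le_floor_of_abs_cast_le (by linarith)
  · exact abs_le_floor_of_abs_cast_le (by linarith)
  · intro η hη
    refine abs_le_floor_of_abs_cast_le ?_
    have h1 := abs_sub (x.a : ℝ) η
    have h2 : |(η : ℝ)| = 1 := by rcases hη with rfl | rfl <;> simp
    push_cast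
    linarith
  · intro η hη
    refine abs_le_floor_of_abs_cast_le ?_
    have h1 := abs_sub (x.e : ℝ) η
    have h2 : |(η : ℝ)| = 1 := by rcases hη with rfl | rfl <;> simp
    push_cast
    linarith
  · refine abs_le_floor_of_abs_cast_le ?_
    push_cast
    linarith

theorem ofReal_tsum_le {ι : Type*} {f : ι → ℝ} (hf : ∀ i, 0 ≤ f i) :
    ENNReal.ofReal (∑' i, f i) ≤ ∑' i, ENNReal.ofReal (f i) := by
  by_cases h : Summable f
  · exact (ENNReal.ofReal_tsum_of_nonneg hf h).le
  · simp [tsum_eq_zero_of_not_summable h]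

theorem ltu_mul_mul_ltu (x y : ℤ) (g : Matrix (Fin 2) (Fin 2) ℤ) :
    ltu y * g * ltu (-x) =
      !![g 0 0 - g 0 1 * x, g 0 1; y * g 0 0 + g 1 0 - (y * g 0 1 + g 1 1) * x,
        y * g 0 1 + g 1 1] := by
  conv_lhs => rw [Matrix.eta_fin_two g, ltu, ltu, Matrix.mul_fin_two, Matrix.mul_fin_two]
  ext i j
  fin_cases i <;> fin_cases j <;> simp <;> ring

theorem ltu_mul_mul_ltu_injective (x y : ℤ) :
    Function.Injective fun g : Matrix (Fin 2) (Fin 2) ℤ => ltu y * g * ltu (-x) := by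
  intro g g' h
  simp only [ltu_mul_mul_ltu] at h
  have h00 := congrFun (congrFun h 0) 0
  have h01 := congrFun (congrFun h 0) 1
  have h10 := congrFun (congrFun h 1) 0
  have h11 := congrFun (congrFun h 1) 1
  simp only [Matrix.of_apply, Matrix.cons_val', Matrix.cons_val_zero, Matrix.cons_val_one,
    Matrix.cons_val_fin_one] at h00 h01 h10 h11
  have e00 : g 0 0 = g' 0 0 := by rw [h01] at h00; linarith
  have e11 : g 1 1 = g' 1 1 := by rw [h01] at h11; linarith
  have e10 : g 1 0 = g' 1 0 := by rw [h01, e00, e11] at h10; linarith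
  ext i j
  fin_cases i <;> fin_cases j <;> assumption

/-- The orbit point with given outer variables and matrix `g`. -/
def ofMatrix (t n₀ n₁ n₂ d : ℕ) (v v' : ℤ) (g : Matrix (Fin 2) (Fin 2) ℤ) : OrbitPoint where
  t := t
  n₀ := n₀
  n₁ := n₁
  n₂ := n₂
  d := d
  v := v
  v' := v'
  a := g 0 0
  b := g 0 1
  c := g 1 0 / (d * n₀ * t ^ 2 * n₁)
  e := g 1 1

theorem exists_of_mem_Gamma0 {s n₁ n₂ : ℕ} {nb v v' : ℤ} (hnb : n₁ * nb ≡ 1 [ZMOD n₂])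
    {g : Matrix (Fin 2) (Fin 2) ℤ} (hg : g ∈ Gamma0 (s * n₁ * n₂))
    {h : Matrix (Fin 2) (Fin 2) ℤ}
    (hh : h = ltu (s * n₁ * v' * nb) * g * ltu (-(s * n₁ * v * nb))) :
    h.det = 1 ∧ ∃ c : ℤ, h 1 0 = s * n₁ * c ∧
      (n₂ : ℤ) ∣ n₁ * c - v' * h 0 0 + v * h 1 1 - s * v * v' * h 0 1 := by
  obtain ⟨hdet, c₀, hc₀⟩ := hg
  obtain ⟨q, hq⟩ := hnb.symm.dvd
  refine ⟨?_, v' * nb * g 0 0 + n₂ * c₀ - v * nb * (s * n₁ * v' * nb * g 0 1 + g 1 1), ?_, ?_⟩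
  · rw [hh, Matrix.det_mul, Matrix.det_mul, hdet]
    simp [ltu, Matrix.det_fin_two]
  · rw [hh, ltu_mul_mul_ltu]
    simp only [Matrix.of_apply, Matrix.cons_val', Matrix.cons_val_zero, Matrix.cons_val_one,
      Matrix.cons_val_fin_one]
    rw [hc₀]
    push_cast
    ring
  · rw [hh, ltu_mul_mul_ltu]
    simp only [Matrix.of_apply, Matrix.cons_val', Matrix.cons_val_zero, Matrix.cons_val_one,
      Matrix.cons_val_fin_one]
    refine ⟨n₁ * c₀ + q * (v' * g 0 0 - v * g 1 1 - s * n₁ * nb * v * v' * g 0 1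
      + s * v * v' * g 0 1), ?_⟩
    linear_combination (v' * g 0 0 - v * g 1 1 - s * n₁ * nb * v * v' * g 0 1
      + s * v * v' * g 0 1) * hq

theorem eq_of_ofMatrix_eq {t n₀ n₁ n₂ d : ℕ} {v v' : ℤ} {g h : Matrix (Fin 2) (Fin 2) ℤ}
    (hg : (d * n₀ * t ^ 2 * n₁ : ℤ) ∣ g 1 0) (hh : (d * n₀ * t ^ 2 * n₁ : ℤ) ∣ h 1 0)
    (hgh : ofMatrix t n₀ n₁ n₂ d v v' g = ofMatrix t n₀ n₁ n₂ d v v' h) : g = h := by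
  simp only [ofMatrix, OrbitPoint.mk.injEq, true_and] at hgh
  obtain ⟨h00, h01, h10, h11⟩ := hgh
  have h10' : g 1 0 = h 1 0 := by
    rw [← Int.mul_ediv_cancel' hg, h10, Int.mul_ediv_cancel' hh]
  ext i j
  fin_cases i <;> fin_cases j <;> assumption

/-- The total weight of the admissible orbit points is an upper bound for the sum over one
orbit. -/
theorem ofReal_tsum_Gamma0_le {k : Matrix (Fin 2) (Fin 2) ℝ → ℝ}
    (hk : ∀ g, 0 ≤ k g ∧
      k g ≤ (if uSize R g ≤ Z then (1 + uSize R g) ^ (-(1 : ℝ) / 2) else 0))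
    {t n₀ n₁ n₂ d : ℕ} {v v' nb : ℤ} (hnb : n₁ * nb ≡ 1 [ZMOD n₂])
    (hcond : 1 ≤ t ∧ (t : ℝ) ≤ T ∧ 1 ≤ n₀ ∧ (n₀ : ℝ) ≤ N₀ ∧ 1 ≤ n₁ ∧ (n₁ : ℝ) ≤ N₁ ∧
          1 ≤ n₂ ∧ (n₂ : ℝ) ≤ N₂ ∧ Nat.Coprime n₁ n₂ ∧ d ∣ n₀ * n₁ * n₂ ∧ D < (d : ℝ))
    (hv : |(v : ℝ)| ≤ V) (hv' : |(v' : ℝ)| ≤ V) :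
    ENNReal.ofReal (∑' γ : Gamma0 (d * n₀ * t ^ 2 * n₁ * n₂),
        k (toR (ltu (((d * n₀ * t ^ 2 : ℕ) : ℤ) * n₁ * v' * nb) *
          (γ : Matrix (Fin 2) (Fin 2) ℤ) * ltu (-(((d * n₀ * t ^ 2 : ℕ) : ℤ) * n₁ * v * nb))))) ≤
      ∑' p : ℤ × ℤ × ℤ × ℤ,
        {x | Admissible D N₀ N₁ N₂ T V Z R x}.indicator (fun x => ENNReal.ofReal (x.wt R))
          ⟨t, n₀, n₁, n₂, d, v, v', p.1, p.2.1, p.2.2.1, p.2.2.2⟩ := by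
  obtain ⟨ht, htT, hn₀, hn₀N, hn₁, hn₁N, hn₂, hn₂N, -, hdvd, hD⟩ := hcond
  set F := {x | Admissible D N₀ N₁ N₂ T V Z R x}.indicator
    fun x => ENNReal.ofReal (x.wt R) with hF
  set h : Gamma0 (d * n₀ * t ^ 2 * n₁ * n₂) → Matrix (Fin 2) (Fin 2) ℤ := fun γ =>
    ltu (((d * n₀ * t ^ 2 : ℕ) : ℤ) * n₁ * v' * nb) * (γ : Matrix (Fin 2) (Fin 2) ℤ) *
      ltu (-(((d * n₀ * t ^ 2 : ℕ) : ℤ) * n₁ * v * nb)) with hh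
  have hmem := fun γ => exists_of_mem_Gamma0 hnb γ.2 (congrFun hh γ)
  have hlow : ∀ γ, (d * n₀ * t ^ 2 * n₁ : ℤ) ∣ h γ 1 0 := by
    intro γ
    obtain ⟨-, c, hc, -⟩ := hmem γ
    exact ⟨c, by rw [hc]; push_cast; ring⟩
  set φ : Gamma0 (d * n₀ * t ^ 2 * n₁ * n₂) → ℤ × ℤ × ℤ × ℤ := fun γ =>
    (h γ 0 0, h γ 0 1, h γ 1 0 / (d * n₀ * t ^ 2 * n₁), h γ 1 1) with hφ
  have hφi : Function.Injective φ := by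
    intro γ γ' e
    refine Subtype.ext (ltu_mul_mul_ltu_injective (((d * n₀ * t ^ 2 : ℕ) : ℤ) * n₁ * v * nb)
      (((d * n₀ * t ^ 2 : ℕ) : ℤ) * n₁ * v' * nb) ?_)
    refine eq_of_ofMatrix_eq (t := t) (n₀ := n₀) (n₁ := n₁) (n₂ := n₂) (d := d) (v := v) (v' := v')
      (hlow γ) (hlow γ') ?_
    simp only [hφ, Prod.mk.injEq] at e
    simp only [ofMatrix, OrbitPoint.mk.injEq, true_and]
    exact e
  refine (ofReal_tsum_le fun γ => (hk _).1).trans (le_trans ?_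
    (ENNReal.tsum_comp_le_tsum_of_injective hφi _))
  refine ENNReal.tsum_le_tsum fun γ => ?_
  change ENNReal.ofReal (k (toR (h γ))) ≤ F (ofMatrix t n₀ n₁ n₂ d v v' (h γ))
  set x := ofMatrix t n₀ n₁ n₂ d v v' (h γ) with hx
  obtain ⟨hdet, c, hc, hres⟩ := hmem γ
  have hs : (d * n₀ * t ^ 2 * n₁ : ℤ) ≠ 0 := by
    have : 0 < d := Nat.pos_of_dvd_of_pos hdvd (by positivity)
    positivity
  have hxc : x.c = c := by
    rw [hx]
    simp only [ofMatrix]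
    rw [hc]
    push_cast
    exact Int.mul_ediv_cancel_left _ hs
  have hmat : x.mat = toR (h γ) := by
    rw [mat, hxc, Matrix.eta_fin_two (toR (h γ))]
    simp only [toR, Matrix.map_apply]
    rw [hc, hx]
    simp [ofMatrix]
  by_cases hu : uSize R x.mat ≤ Z
  · have hadm : x ∈ {x | Admissible D N₀ N₁ N₂ T V Z R x} := by
      refine ⟨ht, htT, hn₀, hn₀N, hn₁, hn₁N, hn₂, hn₂N, hdvd, hD, hv, hv', ?_, ?_, hu⟩
      · rw [hxc, ← hdet, Matrix.det_fin_two, hc, hx]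
        simp [ofMatrix]
      · rw [residue, hxc]
        push_cast at hres
        exact hres
    rw [hF, Set.indicator_of_mem hadm]
    refine ENNReal.ofReal_le_ofReal ?_
    have := (hk x.mat).2
    rw [if_pos hu] at this
    rwa [← hmat]
  · have := (hk x.mat).2
    rw [if_neg hu, hmat] at this
    rw [ENNReal.ofReal_of_nonpos this]
    exact zero_le

theorem tsum_indicator_le {B : ℝ}
    (hB : ∀ S : Finset OrbitPoint, (∀ x ∈ S, Admissible D N₀ N₁ N₂ T V Z R x) →
      ∑ x ∈ S, x.wt R ≤ B) :
    ∑' x, {x | Admissible D N₀ N₁ N₂ T V Z R x}.indicator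
      (fun x => ENNReal.ofReal (x.wt R)) x ≤ ENNReal.ofReal B := by
  rw [ENNReal.tsum_eq_iSup_sum]
  refine iSup_le fun S => ?_
  rw [Finset.sum_indicator_eq_sum_filter, ← ENNReal.ofReal_sum_of_nonneg fun _ _ => wt_nonneg]
  exact ENNReal.ofReal_le_ofReal (hB _ fun x hx => (Finset.mem_filter.1 hx).2)

theorem tsum_Kker_le {k : Matrix (Fin 2) (Fin 2) ℝ → ℝ}
    (hk : ∀ g, 0 ≤ k g ∧
      k g ≤ (if uSize R g ≤ Z then (1 + uSize R g) ^ (-(1 : ℝ) / 2) else 0))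
    {nbar : ℕ → ℕ → ℕ → ℕ → ℕ → ℤ}
    (hnbar : ∀ t n₀ n₁ n₂ d : ℕ, Nat.Coprime n₁ n₂ →
        ((n₁ : ℤ) * nbar t n₀ n₁ n₂ d) ≡ 1 [ZMOD (n₂ : ℤ)])
    {B : ℝ} (hB0 : 0 ≤ B)
    (hB : ∀ S : Finset OrbitPoint, (∀ x ∈ S, Admissible D N₀ N₁ N₂ T V Z R x) →
      ∑ x ∈ S, x.wt R ≤ B) :
    (∑' t : ℕ, ∑' n₀ : ℕ, ∑' n₁ : ℕ, ∑' n₂ : ℕ, ∑' d : ℕ,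
      if 1 ≤ t ∧ (t : ℝ) ≤ T ∧ 1 ≤ n₀ ∧ (n₀ : ℝ) ≤ N₀ ∧ 1 ≤ n₁ ∧ (n₁ : ℝ) ≤ N₁ ∧
          1 ≤ n₂ ∧ (n₂ : ℝ) ≤ N₂ ∧ Nat.Coprime n₁ n₂ ∧ d ∣ n₀ * n₁ * n₂ ∧ D < (d : ℝ) then
        Kker k V (d * n₀ * t ^ 2) n₁ n₂ (nbar t n₀ n₁ n₂ d)
      else 0) ≤ B := by
  set F := {x | Admissible D N₀ N₁ N₂ T V Z R x}.indicator
    fun x => ENNReal.ofReal (x.wt R) with hF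
  have hinner : ∀ (s n₁ n₂ : ℕ) (nb v v' : ℤ), 0 ≤
      if (|v| : ℝ) ≤ V ∧ (|v'| : ℝ) ≤ V then
        ∑' γ : Gamma0 (s * n₁ * n₂),
          k (toR (ltu ((s : ℤ) * (n₁ : ℤ) * v' * nb) * (γ : Matrix (Fin 2) (Fin 2) ℤ) *
            ltu (-((s : ℤ) * (n₁ : ℤ) * v * nb))))
      else 0 := by
    intro s n₁ n₂ nb v v'
    split_ifs
    · exact tsum_nonneg fun _ => (hk _).1
    · exact le_rfl
  have hKnonneg : ∀ (s n₁ n₂ : ℕ) (nb : ℤ), 0 ≤ Kker k V s n₁ n₂ nb := fun s n₁ n₂ nb =>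
    tsum_nonneg fun v => tsum_nonneg fun v' => hinner s n₁ n₂ nb v v'
  have hterm : ∀ t n₀ n₁ n₂ d : ℕ, 0 ≤
      if 1 ≤ t ∧ (t : ℝ) ≤ T ∧ 1 ≤ n₀ ∧ (n₀ : ℝ) ≤ N₀ ∧ 1 ≤ n₁ ∧ (n₁ : ℝ) ≤ N₁ ∧
          1 ≤ n₂ ∧ (n₂ : ℝ) ≤ N₂ ∧ Nat.Coprime n₁ n₂ ∧ d ∣ n₀ * n₁ * n₂ ∧ D < (d : ℝ) then
        Kker k V (d * n₀ * t ^ 2) n₁ n₂ (nbar t n₀ n₁ n₂ d)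
      else 0 := by
    intro t n₀ n₁ n₂ d
    split_ifs
    · exact hKnonneg _ _ _ _
    · exact le_rfl
  refine (ENNReal.ofReal_le_ofReal_iff hB0).1 ?_
  calc _ ≤ ∑' (t : ℕ) (n₀ : ℕ) (n₁ : ℕ) (n₂ : ℕ) (d : ℕ) (v : ℤ) (v' : ℤ)
        (p : ℤ × ℤ × ℤ × ℤ), F ⟨t, n₀, n₁, n₂, d, v, v', p.1, p.2.1, p.2.2.1, p.2.2.2⟩ := by
        refine (ofReal_tsum_le fun t => tsum_nonneg fun n₀ => tsum_nonneg fun n₁ =>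
          tsum_nonneg fun n₂ => tsum_nonneg fun d => hterm t n₀ n₁ n₂ d).trans
          (ENNReal.tsum_le_tsum fun t => ?_)
        refine (ofReal_tsum_le fun n₀ => tsum_nonneg fun n₁ =>
          tsum_nonneg fun n₂ => tsum_nonneg fun d => hterm t n₀ n₁ n₂ d).trans
          (ENNReal.tsum_le_tsum fun n₀ => ?_)
        refine (ofReal_tsum_le fun n₁ =>
          tsum_nonneg fun n₂ => tsum_nonneg fun d => hterm t n₀ n₁ n₂ d).trans
          (ENNReal.tsum_le_tsum fun n₁ => ?_)
        refine (ofReal_tsum_le fun n₂ => tsum_nonneg fun d => hterm t n₀ n₁ n₂ d).trans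
          (ENNReal.tsum_le_tsum fun n₂ => ?_)
        refine (ofReal_tsum_le fun d => hterm t n₀ n₁ n₂ d).trans
          (ENNReal.tsum_le_tsum fun d => ?_)
        split_ifs with hcond
        · rw [Kker]
          refine (ofReal_tsum_le fun v => tsum_nonneg fun v' => hinner _ _ _ _ v v').trans
            (ENNReal.tsum_le_tsum fun v => ?_)
          refine (ofReal_tsum_le fun v' => hinner _ _ _ _ v v').trans
            (ENNReal.tsum_le_tsum fun v' => ?_)
          split_ifs with hv
          · exact ofReal_tsum_Gamma0_le hk (hnbar _ _ _ _ _ hcond.2.2.2.2.2.2.2.2.1) hcond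
              (by simpa using hv.1) (by simpa using hv.2)
          · simp
        · simp
    _ = ∑' p : ℕ × ℕ × ℕ × ℕ × ℕ × ℤ × ℤ × ℤ × ℤ × ℤ × ℤ,
        F ⟨p.1, p.2.1, p.2.2.1, p.2.2.2.1, p.2.2.2.2.1, p.2.2.2.2.2.1, p.2.2.2.2.2.2.1,
          p.2.2.2.2.2.2.2.1, p.2.2.2.2.2.2.2.2.1, p.2.2.2.2.2.2.2.2.2.1,
          p.2.2.2.2.2.2.2.2.2.2⟩ := by
        simp only [ENNReal.tsum_prod']
    _ ≤ ∑' x, F x := by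
        refine ENNReal.tsum_comp_le_tsum_of_injective (f := fun p :
          ℕ × ℕ × ℕ × ℕ × ℕ × ℤ × ℤ × ℤ × ℤ × ℤ × ℤ => (⟨p.1, p.2.1, p.2.2.1, p.2.2.2.1,
          p.2.2.2.2.1, p.2.2.2.2.2.1, p.2.2.2.2.2.2.1, p.2.2.2.2.2.2.2.1, p.2.2.2.2.2.2.2.2.1,
          p.2.2.2.2.2.2.2.2.2.1, p.2.2.2.2.2.2.2.2.2.2⟩ : OrbitPoint)) ?_ F
        rintro ⟨⟩ ⟨⟩ h
        simpa [Prod.ext_iff] using h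
    _ ≤ _ := tsum_indicator_le hB

theorem exists_divisorCountLE_pow_mul_le {ε : ℝ} (hε : 0 < ε) :
    ∃ C : ℝ, 0 < C ∧ ∀ Q : ℝ, 1 ≤ Q → ∃ K : ℕ, 1 ≤ K ∧ DivisorCountLE K ⌊12 * Q ^ 10⌋₊ ∧
      (K : ℝ) ^ 6 * symmHarmonic ⌊12 * Q ^ 10⌋₊ ≤ C * Q ^ ε := by
  set δ := ε / 70 with hδ
  have hδ0 : 0 < δ := by positivity
  obtain ⟨C, hC1, hC⟩ := exists_card_divisors_le δ hδ0
  refine ⟨(2 * C) ^ 6 * (3 + 2 / δ) * ((12 : ℝ) ^ δ) ^ 7, by positivity, fun Q hQ => ?_⟩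
  set y := 12 * Q ^ 10 with hy
  have hy1 : 1 ≤ y := by linarith [one_le_pow₀ hQ (n := 10)]
  have hyδ : 1 ≤ y ^ δ := Real.one_le_rpow hy1 hδ0.le
  have hfloor : (⌊y⌋₊ : ℝ) ≤ y := Nat.floor_le (by linarith)
  have hK1 : 1 ≤ 2 * C * y ^ δ := by nlinarith
  refine ⟨⌊2 * C * y ^ δ⌋₊, Nat.le_floor (by exact_mod_cast hK1), fun n hn hnM => ?_, ?_⟩
  · refine Nat.le_floor ?_
    have h1 := hC n.natAbs (Int.natAbs_ne_zero.2 hn)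
    have h2 : (n.natAbs : ℝ) ≤ y := by
      refine le_trans ?_ hfloor
      rw [Int.abs_eq_natAbs] at hnM
      exact_mod_cast hnM
    push_cast
    calc 2 * (n.natAbs.divisors.card : ℝ) ≤ 2 * (C * (n.natAbs : ℝ) ^ δ) := by gcongr
      _ ≤ 2 * (C * y ^ δ) := by gcongr
      _ = _ := by ring
  · have hM1 : 1 ≤ ⌊y⌋₊ := Nat.le_floor (by exact_mod_cast hy1)
    have hL : symmHarmonic ⌊y⌋₊ ≤ (3 + 2 / δ) * y ^ δ := by
      have h1 := symmHarmonic_le ⌊y⌋₊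
      have h2 : Real.log ⌊y⌋₊ ≤ Real.log y :=
        Real.log_le_log (by exact_mod_cast hM1) hfloor
      have h3 := Real.log_le_rpow_div (by linarith : 0 ≤ y) hδ0
      calc _ ≤ 3 + 2 * Real.log ⌊y⌋₊ := h1
        _ ≤ 3 * y ^ δ + 2 * (y ^ δ / δ) := by linarith
        _ = _ := by ring
    have hQ0 : 0 ≤ Q := by linarith
    have hyQ : (y ^ δ) ^ 7 = ((12 : ℝ) ^ δ) ^ 7 * Q ^ ε := by
      rw [hy, Real.mul_rpow (by norm_num) (by positivity), mul_pow, ← Real.rpow_natCast Q 10,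
        ← Real.rpow_mul hQ0, ← Real.rpow_natCast (Q ^ _) 7, ← Real.rpow_mul hQ0, hδ]
      congr 2
      push_cast
      ring
    have hKle : (⌊2 * C * y ^ δ⌋₊ : ℝ) ≤ 2 * C * y ^ δ := Nat.floor_le (by linarith)
    have hL0 : 0 ≤ symmHarmonic ⌊y⌋₊ := by linarith [one_le_symmHarmonic ⌊y⌋₊]
    calc _ ≤ (2 * C * y ^ δ) ^ 6 * ((3 + 2 / δ) * y ^ δ) := by gcongr
      _ = (2 * C) ^ 6 * (3 + 2 / δ) * (y ^ δ) ^ 7 := by ring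
      _ = _ := by rw [hyQ]; ring

end Cases

end OrbitPoint

end Configurations

/-- **Kernel bound for lower-triangular orbits.** For every `ε > 0` there is `C > 0` such
that for all `D,N₀,N₁,N₂,T,V,Z ≥ 1`, `R > 0`, any kernel `k` with
`0 ≤ k(g) ≤ 1{u_R(g) ≤ Z}(1+u_R(g))^{−1/2}`, and any choice `n̄₁` of inverses of `n₁`
mod `n₂` (one for each tuple `(t,n₀,n₁,n₂,d)`):
`Σ_{t ≤ T} Σ_{n₀ ≤ N₀} Σ_{n₁ ≤ N₁} Σ_{n₂ ≤ N₂, (n₁,n₂)=1} Σ_{d ∣ n₀n₁n₂, d > D}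
  K(dn₀t², n₁, n₂) ≤ C·P^ε·(N₀TV(1+R)(N₁N₂+N₁V+N₂V) + V²((DR)^{−1} + Z^{1/2}))`,
with `P = DN₀N₁N₂TVZ(2+R+R⁻¹)`. -/
theorem stmt10 :
    ∀ ε : ℝ, 0 < ε → ∃ C : ℝ, 0 < C ∧
    ∀ D N₀ N₁ N₂ T V Z R : ℝ,
      1 ≤ D → 1 ≤ N₀ → 1 ≤ N₁ → 1 ≤ N₂ → 1 ≤ T → 1 ≤ V → 1 ≤ Z → 0 < R →
    ∀ k : Matrix (Fin 2) (Fin 2) ℝ → ℝ,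
      (∀ g, 0 ≤ k g ∧
        k g ≤ (if uSize R g ≤ Z then (1 + uSize R g) ^ (-(1 : ℝ) / 2) else 0)) →
    ∀ nbar : ℕ → ℕ → ℕ → ℕ → ℕ → ℤ,
      (∀ t n₀ n₁ n₂ d : ℕ, Nat.Coprime n₁ n₂ →
        ((n₁ : ℤ) * nbar t n₀ n₁ n₂ d) ≡ 1 [ZMOD (n₂ : ℤ)]) →
    (∑' t : ℕ, ∑' n₀ : ℕ, ∑' n₁ : ℕ, ∑' n₂ : ℕ, ∑' d : ℕ,
      if 1 ≤ t ∧ (t : ℝ) ≤ T ∧ 1 ≤ n₀ ∧ (n₀ : ℝ) ≤ N₀ ∧ 1 ≤ n₁ ∧ (n₁ : ℝ) ≤ N₁ ∧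
          1 ≤ n₂ ∧ (n₂ : ℝ) ≤ N₂ ∧ Nat.Coprime n₁ n₂ ∧ d ∣ n₀ * n₁ * n₂ ∧ D < (d : ℝ) then
        Kker k V (d * n₀ * t ^ 2) n₁ n₂ (nbar t n₀ n₁ n₂ d)
      else 0)
      ≤ C * (D * N₀ * N₁ * N₂ * T * V * Z * (2 + R + R⁻¹)) ^ ε *
          (N₀ * T * V * (1 + R) * (N₁ * N₂ + N₁ * V + N₂ * V) +
            V ^ 2 * ((D * R)⁻¹ + Z ^ ((1 : ℝ) / 2))) := by
  intro ε hε
  obtain ⟨C, hC, hCQ⟩ := OrbitPoint.exists_divisorCountLE_pow_mul_le hε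
  refine ⟨318 * C, by positivity, ?_⟩
  intro D N₀ N₁ N₂ T V Z R hD hN₀ hN₁ hN₂ hT hV hZ hR k hk nbar hnbar
  set Q := D * N₀ * N₁ * N₂ * T * V * Z * (2 + R + R⁻¹) with hQ
  have hR' : 0 < R⁻¹ := inv_pos.2 hR
  have hle : ∀ y z : ℝ, 1 ≤ y → 1 ≤ z → y ≤ y * z ∧ z ≤ y * z ∧ 1 ≤ y * z := fun y z hy hz =>
    ⟨le_mul_of_one_le_right (by linarith) hz, le_mul_of_one_le_left (by linarith) hy,
      one_le_mul_of_one_le_of_one_le hy hz⟩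
  obtain ⟨-, a1, b1⟩ := hle D N₀ hD hN₀
  obtain ⟨c2, a2, b2⟩ := hle (D * N₀) N₁ b1 hN₁
  obtain ⟨c3, a3, b3⟩ := hle (D * N₀ * N₁) N₂ b2 hN₂
  obtain ⟨c4, a4, b4⟩ := hle (D * N₀ * N₁ * N₂) T b3 hT
  obtain ⟨c5, a5, b5⟩ := hle (D * N₀ * N₁ * N₂ * T) V b4 hV
  obtain ⟨c6, a6, b6⟩ := hle (D * N₀ * N₁ * N₂ * T * V) Z b5 hZ
  obtain ⟨c7, a7, b7⟩ := hle (D * N₀ * N₁ * N₂ * T * V * Z) (2 + R + R⁻¹) b6 (by linarith)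
  rw [← hQ] at c7 a7 b7
  clear_value Q
  obtain ⟨K, hK1, hK, hKQ⟩ := hCQ Q b7
  rw [← Real.sqrt_eq_rpow]
  refine OrbitPoint.tsum_Kker_le hk hnbar (by positivity) fun S hS => ?_
  refine (OrbitPoint.sum_wt_le hK hK1 hD hN₀ hN₁ hN₂ hT hV hZ hR S fun x hx =>
    ⟨hS x hx, (hS x hx).boundedBy hR b7 ?_ ?_ ?_ ?_ ?_ ?_ ?_ ?_⟩).trans ?_
  any_goals linarith
  rw [← mul_assoc, mul_assoc 318 C]
  gcongr
end

section
/- (Poisson summation for the local densities ϱ_{a,by³}(d)) For every η ∈ (0,1), ε > 0, c > 0 and every sequence of positive constants (C_J)_{J≥0}, there exists C > 0 such that the following holds. Let B ≥ 3, let δ ∈ [(log B)^{−c}, 1), let f₂ : ℝ → ℝ be smooth, supported in [1, 1+δ], with sup|f₂^{(J)}| ≤ C_J δ^{−J} for all J ≥ 0; let a, b be coprime positive integers, and let d be a squarefree positive integer with d ≤ B^{1−η}. Then | Σ_{y ∈ ℤ} f₂(y/B) · ϱ_{a,by³}(d) − B · ∫_ℝ f₂(u) du | ≤ C · B^{η²}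 · d^{1/2 + ε}, where ϱ_{a,by³}(d) := #{x ∈ ℤ/dℤ : a x² + b y³ ≡ 0 (mod d)}. -/
open scoped Classical

/-- The local density `ϱ_{a,m}(d) := #{x ∈ ℤ/dℤ : a x² + m ≡ 0 (mod d)}`. -/
noncomputable def rhoDensity' (a m : ℤ) (d : ℕ) : ℕ :=
  Nat.card {x : ZMod d // (a : ZMod d) * x ^ 2 + (m : ZMod d) = 0}

/-- The number of pairs `(x, y)` in `R × R` on the cuspidal cubic `a x² + b y³ = 0`. -/
noncomputable def cuspCard (R : Type*) [CommRing R] (a b : ℕ) : ℕ :=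
  Nat.card {q : R × R // (a : R) * q.1 ^ 2 + (b : R) * q.2 ^ 3 = 0}

lemma cuspCard_congr {R S : Type*} [CommRing R] [CommRing S] (e : R ≃+* S) (a b : ℕ) :
    cuspCard R a b = cuspCard S a b := by
  refine Nat.card_congr ((Equiv.prodCongr e.toEquiv e.toEquiv).subtypeEquiv ?_)
  rintro ⟨x, y⟩
  rw [← map_eq_zero_iff e e.injective]
  simp

lemma cuspCard_prod (R S : Type*) [CommRing R] [CommRing S] (a b : ℕ) :
    cuspCard (R × S) a b = cuspCard R a b * cuspCard S a b := by
  rw [cuspCard, cuspCard, cuspCard, ← Nat.card_prod]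
  refine Nat.card_congr (((Equiv.prodProdProdComm R S R S).subtypeEquiv ?_).trans
    (Equiv.subtypeProdEquivProd (p := fun q : R × R => (a : R) * q.1 ^ 2 + (b : R) * q.2 ^ 3 = 0)
      (q := fun q : S × S => (a : S) * q.1 ^ 2 + (b : S) * q.2 ^ 3 = 0)))
  rintro ⟨⟨x, x'⟩, ⟨y, y'⟩⟩
  simp [Prod.ext_iff]

lemma cuspCard_field (F : Type*) [Field F] {a b : ℕ} (h : (a : F) ≠ 0 ∨ (b : F) ≠ 0) :
    cuspCard F a b = Nat.card F := by
  symm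
  by_cases ha : (a : F) = 0
  · have hb : (b : F) ≠ 0 := h.resolve_left (not_not_intro ha)
    refine Nat.card_congr ⟨fun x => ⟨(x, 0), by simp [ha]⟩, fun q => q.1.1, fun x => rfl, ?_⟩
    rintro ⟨⟨x, y⟩, hq⟩
    have hy : y = 0 := by simpa [ha, hb] using hq
    simp [hy]
  by_cases hb : (b : F) = 0
  · refine Nat.card_congr ⟨fun y => ⟨(0, y), by simp [hb]⟩, fun q => q.1.2, fun y => rfl, ?_⟩
    rintro ⟨⟨x, y⟩, hq⟩
    have hx : x = 0 := by simpa [ha, hb] using hq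
    simp [hx]
  refine Nat.card_congr ⟨fun t => ⟨(t * (-a * t ^ 2 / b), -a * t ^ 2 / b), ?_⟩,
    fun q => q.1.1 / q.1.2, ?_, ?_⟩
  · field_simp
    ring
  · intro t
    by_cases ht : t = 0
    · simp [ht]
    · have : -(a : F) * t ^ 2 / b ≠ 0 := by simp [ha, hb, ht]
      exact mul_div_cancel_right₀ _ this
  · rintro ⟨⟨x, y⟩, hq⟩
    by_cases hy : y = 0
    · have hx : x = 0 := by simpa [ha, hy] using hq
      simp [hx, hy]
    · simp only at hq
      have key : -(a : F) * (x / y) ^ 2 / b = y := by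
        field_simp
        linear_combination -hq
      simp only [key, Subtype.mk.injEq, Prod.mk.injEq, and_true]
      field_simp

lemma cuspCard_zmod {a b : ℕ} (hab : Nat.Coprime a b) {d : ℕ} (hd : Squarefree d) :
    cuspCard (ZMod d) a b = d := by
  induction d using induction_on_primes with
  | zero => exact absurd hd not_squarefree_zero
  | one =>
    have : Subsingleton (ZMod 1) := inferInstance
    rw [cuspCard, Nat.card_eq_one_iff_unique]
    exact ⟨inferInstance, ⟨⟨0, Subsingleton.elim _ _⟩⟩⟩
  | prime_mul p m hp ih =>
    obtain ⟨hc, -, hm⟩ := Nat.squarefree_mul_iff.1 hd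
    have := Fact.mk hp
    rw [cuspCard_congr (ZMod.chineseRemainder hc), cuspCard_prod, ih hm, cuspCard_field,
      Nat.card_zmod]
    simp only [Ne, ZMod.natCast_eq_zero_iff, ← not_and_or]
    rintro ⟨h1, h2⟩
    exact Nat.not_coprime_of_dvd_of_dvd hp.one_lt h1 h2 hab

/-- The local densities `ϱ_{a,by³}(d)` have mean value one over `y` modulo `d`. -/
lemma sum_rhoDensity' {a b : ℕ} (hab : Nat.Coprime a b) {d : ℕ} (hd : Squarefree d) :
    ∑ r ∈ Finset.range d, rhoDensity' a (b * (r : ℤ) ^ 3) d = d := by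
  obtain ⟨n, rfl⟩ := Nat.exists_eq_add_one_of_ne_zero hd.ne_zero
  have h1 : ∑ r ∈ Finset.range (n + 1), rhoDensity' a (b * (r : ℤ) ^ 3) (n + 1) =
      ∑ y : ZMod (n + 1), Nat.card {x : ZMod (n + 1) // (a : ZMod (n + 1)) * x ^ 2 +
        (b : ZMod (n + 1)) * y ^ 3 = 0} := by
    rw [← Fin.sum_univ_eq_sum_range (fun r => rhoDensity' a (b * (r : ℤ) ^ 3) (n + 1))]
    refine Finset.sum_congr rfl fun i _ => ?_
    have hi : (((i : ℕ) : ZMod (n + 1))) = i := Fin.cast_val_eq_self i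
    simp only [rhoDensity', Int.cast_mul, Int.cast_natCast, Int.cast_pow, hi]
  rw [h1, ← Nat.card_sigma]
  refine Eq.trans ?_ (cuspCard_zmod hab hd)
  refine Nat.card_congr ⟨fun q => ⟨(q.2.1, q.1), q.2.2⟩, fun q => ⟨q.1.2, q.1.1, q.2⟩,
    fun _ => rfl, fun _ => rfl⟩

lemma rhoDensity'_add_mul (a b : ℤ) (y k : ℤ) (d : ℕ) :
    rhoDensity' a (b * (y + d * k) ^ 3) d = rhoDensity' a (b * y ^ 3) d := by
  simp [rhoDensity']

lemma abs_sub_integral_le_of_deriv {F : ℝ → ℝ} (hF : ContDiff ℝ (⊤ : ℕ∞) F) {M : ℝ}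
    (hM : ∀ x ∈ Set.Icc (0 : ℝ) 1, |deriv F x| ≤ M) :
    ∀ x ∈ Set.Icc (0 : ℝ) 1, |F x - ∫ t in (0 : ℝ)..1, F t| ≤ M := by
  intro x hx
  have hM0 : 0 ≤ M := (abs_nonneg _).trans (hM x hx)
  have h1 : F x - ∫ t in (0 : ℝ)..1, F t = ∫ t in (0 : ℝ)..1, (F x - F t) := by
    rw [intervalIntegral.integral_sub intervalIntegrable_const
      (hF.continuous.intervalIntegrable _ _)]
    simp
  have h2 : ∀ t ∈ Set.uIoc (0 : ℝ) 1, ‖F x - F t‖ ≤ M := by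
    intro t ht
    rw [Set.uIoc_of_le zero_le_one] at ht
    have := (convex_Icc (0 : ℝ) 1).norm_image_sub_le_of_norm_deriv_le (f := F) (C := M)
      (fun y _ => (hF.differentiable (by simp)).differentiableAt) hM ⟨ht.1.le, ht.2⟩ hx
    refine this.trans (mul_le_of_le_one_right hM0 ?_)
    rw [Real.norm_eq_abs, abs_le]
    constructor <;> linarith [hx.1, hx.2, ht.1, ht.2]
  rw [h1]
  simpa using intervalIntegral.norm_integral_le_of_norm_le_const h2

/-- A function whose derivatives agree at the ends of `[0, 1]` differs from its mean by at most
the supremum of any of its derivatives. -/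
lemma abs_sub_integral_le_of_iteratedDeriv (J : ℕ) {F : ℝ → ℝ} (hF : ContDiff ℝ (⊤ : ℕ∞) F)
    (hper : ∀ j, iteratedDeriv j F 1 = iteratedDeriv j F 0) {M : ℝ}
    (hM : ∀ x ∈ Set.Icc (0 : ℝ) 1, |iteratedDeriv (J + 1) F x| ≤ M) :
    ∀ x ∈ Set.Icc (0 : ℝ) 1, |F x - ∫ t in (0 : ℝ)..1, F t| ≤ M := by
  induction J generalizing F with
  | zero => exact abs_sub_integral_le_of_deriv hF (by simpa [iteratedDeriv_one] using hM)
  | succ J ih =>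
    have hF' : ContDiff ℝ (⊤ : ℕ∞) (deriv F) := (contDiff_infty_iff_deriv.1 hF).2
    have h0 : ∫ t in (0 : ℝ)..1, deriv F t = 0 := by
      rw [intervalIntegral.integral_deriv_eq_sub
        (fun x _ => (hF.differentiable (by simp)).differentiableAt)
        (hF'.continuous.intervalIntegrable _ _)]
      simpa [sub_eq_zero] using hper 0
    have := ih hF' (fun j => by simpa [iteratedDeriv_succ'] using hper (j + 1))
      (by simpa [iteratedDeriv_succ'] using hM)
    exact abs_sub_integral_le_of_deriv hF (by simpa [h0] using this)

lemma iteratedDeriv_eq_zero_of_notMem_tsupport {f : ℝ → ℝ} {x : ℝ} (hx : x ∉ tsupport f) (j : ℕ) :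
    iteratedDeriv j f x = 0 := by
  have : x ∉ Function.support (iteratedFDeriv ℝ j f) :=
    fun h => hx (support_iteratedFDeriv_subset j h)
  simp [iteratedDeriv, Function.notMem_support.1 this]

lemma iteratedDeriv_comp_add_mul {f : ℝ → ℝ} (hf : ContDiff ℝ (⊤ : ℕ∞) f) (j : ℕ) (α s : ℝ) :
    iteratedDeriv j (fun t => f (α + s * t)) =
      fun t => s ^ j * iteratedDeriv j f (α + s * t) := by
  have hg : ContDiff ℝ j (fun t => f (α + t)) :=
    (hf.of_le (by exact_mod_cast le_top)).comp (contDiff_const.add contDiff_id)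
  rw [iteratedDeriv_comp_const_mul hg s, iteratedDeriv_comp_const_add]

/-- Riemann sums of a smooth compactly supported function approximate its integral to
arbitrary order in the step `s`. -/
lemma abs_sum_sub_integral_le {f : ℝ → ℝ} (hf : ContDiff ℝ (⊤ : ℕ∞) f) {u v : ℝ}
    (hsupp : Function.support f ⊆ Set.Icc u v) {α s : ℝ} (hα : α < u) (hs : 0 < s) {K : ℕ}
    (hK : v < α + s * K) (J : ℕ) {D : ℝ}
    (hD : ∀ x, |iteratedDeriv (J + 1) f x| ≤ D) :
    |∑ k ∈ Finset.range K, f (α + s * k) - s⁻¹ * ∫ x, f x| ≤ K * (s ^ (J + 1) * D) := by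
  set F : ℝ → ℝ := fun t => ∑ k ∈ Finset.range K, f (α + s * k + s * t) with hFdef
  have hterm : ∀ k : ℕ, ContDiff ℝ (⊤ : ℕ∞) (fun t : ℝ => f (α + s * k + s * t)) := fun k =>
    hf.comp (contDiff_const.add (contDiff_const.mul contDiff_id))
  have hF : ContDiff ℝ (⊤ : ℕ∞) F := ContDiff.sum fun k _ => hterm k
  have hFd : ∀ (j : ℕ) (t : ℝ), iteratedDeriv j F t =
      ∑ k ∈ Finset.range K, s ^ j * iteratedDeriv j f (α + s * k + s * t) := by
    intro j t
    rw [hFdef, iteratedDeriv_fun_sum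
      fun k _ => ((hterm k).of_le (by exact_mod_cast le_top)).contDiffAt]
    exact Finset.sum_congr rfl fun k _ => by rw [iteratedDeriv_comp_add_mul hf]
  have hzero : ∀ (j : ℕ) (x : ℝ), x ∉ Set.Icc u v → iteratedDeriv j f x = 0 := fun j x hx =>
    iteratedDeriv_eq_zero_of_notMem_tsupport
      (fun h => hx (closure_minimal hsupp isClosed_Icc h)) j
  have hper : ∀ j, iteratedDeriv j F 1 = iteratedDeriv j F 0 := by
    intro j
    rw [← sub_eq_zero, hFd, hFd, ← Finset.sum_sub_distrib]
    have := Finset.sum_range_sub (fun k : ℕ => s ^ j * iteratedDeriv j f (α + s * k)) K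
    rw [hzero j (α + s * K) (fun h => by linarith [h.2]),
      hzero j (α + s * (0 : ℕ)) (fun h => by have := h.1; simp at this; linarith)] at this
    simp only [mul_zero, sub_zero] at this
    refine Eq.trans (Finset.sum_congr rfl fun k _ => ?_) this
    push_cast
    ring_nf
  have hbound : ∀ x ∈ Set.Icc (0 : ℝ) 1, |iteratedDeriv (J + 1) F x| ≤ K * (s ^ (J + 1) * D) := by
    intro x _
    rw [hFd]
    refine (Finset.abs_sum_le_sum_abs _ _).trans ((Finset.sum_le_card_nsmul _ _
      (s ^ (J + 1) * D) fun k _ => ?_).trans (by simp))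
    rw [abs_mul, abs_of_pos (pow_pos hs _)]
    exact mul_le_mul_of_nonneg_left (hD _) (pow_pos hs _).le
  have hint : ∫ t in (0 : ℝ)..1, F t = s⁻¹ * ∫ x, f x := by
    rw [hFdef, intervalIntegral.integral_finsetSum
      fun k _ => (hterm k).continuous.intervalIntegrable _ _]
    have h1 : ∀ k : ℕ, ∫ t in (0 : ℝ)..1, f (α + s * k + s * t) =
        ∫ t in (k : ℝ)..((k + 1 : ℕ) : ℝ), f (α + s * t) := by
      intro k
      have := intervalIntegral.integral_comp_add_right (a := (0 : ℝ)) (b := 1)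
        (fun t => f (α + s * t)) (k : ℝ)
      rw [zero_add, add_comm (1 : ℝ)] at this
      rw [Nat.cast_succ, ← this]
      congr 1
      ext t
      ring_nf
    have hcont : Continuous fun t : ℝ => f (α + s * t) := hf.continuous.comp (by fun_prop)
    simp only [h1]
    rw [intervalIntegral.sum_integral_adjacent_intervals (a := fun k : ℕ => (k : ℝ)) fun k _ =>
      hcont.intervalIntegrable _ _,
      intervalIntegral.integral_comp_add_mul _ hs.ne', smul_eq_mul,
      intervalIntegral.integral_eq_integral_of_support_subset]
    intro x hx
    have := hsupp hx
    exact ⟨by have := this.1; simp; linarith, this.2.trans hK.le⟩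
  have := abs_sub_integral_le_of_iteratedDeriv J hF hper hbound 0 (by simp)
  rw [hint] at this
  simpa [hFdef] using this

lemma sum_range_mul_eq_sum_sum {M : Type*} [AddCommMonoid M] (h : ℕ → M) (d K : ℕ) :
    ∑ n ∈ Finset.range (d * K), h n =
      ∑ r ∈ Finset.range d, ∑ k ∈ Finset.range K, h (r + d * k) := by
  rw [Finset.sum_comm]
  induction K with
  | zero => simp
  | succ K ih =>
    rw [Finset.sum_range_succ, ← ih, mul_add_one, Finset.sum_range_add]
    simp only [add_comm]

/-- Comparison of the sum weighted by local densities with its main term: only the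
Riemann sum error in each residue class modulo `d` contributes. -/
lemma abs_tsum_rhoDensity'_sub_le {a b d : ℕ} (hab : Nat.Coprime a b) (hd : Squarefree d)
    {B : ℝ} (hdB : (d : ℝ) ≤ B) {f : ℝ → ℝ} (hf : ContDiff ℝ (⊤ : ℕ∞) f)
    (hsupp : Function.support f ⊆ Set.Icc 1 2) (J : ℕ) {D : ℝ}
    (hD : ∀ x, |iteratedDeriv (J + 1) f x| ≤ D) :
    |(∑' y : ℤ, f ((y : ℝ) / B) * (rhoDensity' (a : ℤ) ((b : ℤ) * y ^ 3) d : ℝ))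
        - B * ∫ u : ℝ, f u| ≤ d * (⌈3 * B⌉₊ * ((d / B) ^ (J + 1) * D)) := by
  have hd0 : (0 : ℝ) < d := by exact_mod_cast hd.ne_zero.bot_lt
  have hd1 : (1 : ℝ) ≤ d := by exact_mod_cast hd.ne_zero.bot_lt
  have hB : 0 < B := hd0.trans_le hdB
  set K := ⌈3 * B⌉₊ with hKdef
  have hK : 3 * B ≤ d * K := (Nat.le_ceil _).trans
    (le_mul_of_one_le_left (Nat.cast_nonneg _) hd1)
  set g : ℤ → ℝ := fun y => f ((y : ℝ) / B) * (rhoDensity' (a : ℤ) ((b : ℤ) * y ^ 3) d : ℝ)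
  have hsum : ∑' y, g y = ∑ n ∈ Finset.range (d * K), g n := by
    rw [tsum_eq_sum (s := (Finset.range (d * K)).map Nat.castEmbedding), Finset.sum_map]
    · rfl
    intro y hy
    by_contra hne
    have hy1 := hsupp (left_ne_zero_of_mul hne)
    rw [Set.mem_Icc, le_div_iff₀ hB, div_le_iff₀ hB] at hy1
    have hy0 : 0 ≤ y := by
      have : (0 : ℝ) ≤ y := by linarith
      exact_mod_cast this
    lift y to ℕ using hy0
    refine hy (Finset.mem_map.2 ⟨y, Finset.mem_range.2 ?_, rfl⟩)
    have : (y : ℝ) < (d * K : ℕ) := by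
      push_cast at hy1 ⊢
      linarith
    exact_mod_cast this
  have hρ : ∑ r ∈ Finset.range d, (rhoDensity' (a : ℤ) (b * (r : ℤ) ^ 3) d : ℝ) = d := by
    exact_mod_cast sum_rhoDensity' hab hd
  have hsplit : ∑' y, g y - B * ∫ u, f u = ∑ r ∈ Finset.range d,
      (rhoDensity' (a : ℤ) (b * (r : ℤ) ^ 3) d : ℝ) *
        (∑ k ∈ Finset.range K, f (r / B + d / B * k) - (d / B)⁻¹ * ∫ u, f u) := by
    simp only [mul_sub]
    rw [Finset.sum_sub_distrib, ← Finset.sum_mul, hρ, hsum,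
      sum_range_mul_eq_sum_sum (fun n => g n)]
    congr 1
    · refine Finset.sum_congr rfl fun r _ => ?_
      rw [Finset.mul_sum]
      refine Finset.sum_congr rfl fun k _ => ?_
      have := rhoDensity'_add_mul a b r k d
      simp only [g]
      push_cast
      rw [this, mul_comm]
      congr 2
      ring
    · field_simp
  rw [hsplit]
  refine (Finset.abs_sum_le_sum_abs _ _).trans ?_
  have hρ' := congrArg (· * (K * ((d / B) ^ (J + 1) * D))) hρ
  rw [Finset.sum_mul] at hρ'
  refine (Finset.sum_le_sum fun r hr => ?_).trans_eq hρ'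
  rw [abs_mul, Nat.abs_cast]
  refine mul_le_mul_of_nonneg_left ?_ (Nat.cast_nonneg _)
  have hrd : (r : ℝ) < d := by exact_mod_cast Finset.mem_range.1 hr
  refine abs_sum_sub_integral_le hf hsupp ((div_lt_one hB).2 (hrd.trans_le hdB))
    (div_pos hd0 hB) ?_ J hD
  rw [div_mul_eq_mul_div, ← add_div, lt_div_iff₀ hB]
  linarith [(Nat.cast_nonneg r : (0 : ℝ) ≤ r)]

lemma log_rpow_le_mul_rpow {η c : ℝ} (hη : 0 < η) (hc : 0 < c) :
    ∃ M : ℝ, 0 < M ∧ ∀ B : ℝ, 1 ≤ B → Real.log B ^ c ≤ M * B ^ (η / 2) := by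
  have hε : 0 < η / (2 * c) := by positivity
  refine ⟨((η / (2 * c))⁻¹) ^ c, by positivity, fun B hB => ?_⟩
  have hB0 : 0 ≤ B := by linarith
  calc Real.log B ^ c ≤ (B ^ (η / (2 * c)) / (η / (2 * c))) ^ c :=
        Real.rpow_le_rpow (Real.log_nonneg hB) (Real.log_le_rpow_div hB0 hε) hc.le
    _ = ((η / (2 * c))⁻¹) ^ c * B ^ (η / 2) := by
        rw [div_eq_inv_mul, Real.mul_rpow (by positivity) (by positivity), ← Real.rpow_mul hB0]
        congr 2
        field_simp

/-- **Poisson summation for the local densities `ϱ_{a,by³}(d)`.**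
For every `η ∈ (0,1)`, `ε > 0`, `c > 0` and positive constants `(C_J)` there is `C > 0`
such that: for `B ≥ 3`, `δ ∈ [(log B)^{−c}, 1)`, `f₂` smooth supported in `[1,1+δ]` with
`sup|f₂^{(J)}| ≤ C_J δ^{−J}`, coprime positive `a, b`, and squarefree `d ≤ B^{1−η}`,
`|Σ_{y∈ℤ} f₂(y/B)·ϱ_{a,by³}(d) − B·∫f₂| ≤ C·B^{η²}·d^{1/2+ε}`. -/
theorem stmt12 :
    ∀ η : ℝ, 0 < η → η < 1 → ∀ ε : ℝ, 0 < ε → ∀ c : ℝ, 0 < c →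
    ∀ CJ : ℕ → ℝ, (∀ J, 0 < CJ J) →
    ∃ C : ℝ, 0 < C ∧
    ∀ B : ℝ, 3 ≤ B → ∀ δ : ℝ, (Real.log B) ^ (-c) ≤ δ → δ < 1 →
    ∀ f₂ : ℝ → ℝ, ContDiff ℝ (⊤ : ℕ∞) f₂ → Function.support f₂ ⊆ Set.Icc 1 (1 + δ) →
      (∀ J : ℕ, ∀ x : ℝ, |iteratedDeriv J f₂ x| ≤ CJ J * δ ^ (-(J : ℝ))) →
    ∀ a b : ℕ, 0 < a → 0 < b → Nat.Coprime a b →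
    ∀ d : ℕ, 0 < d → Squarefree d → (d : ℝ) ≤ B ^ (1 - η) →
    |(∑' y : ℤ, f₂ ((y : ℝ) / B) * (rhoDensity' (a : ℤ) ((b : ℤ) * y ^ 3) d : ℝ))
        - B * ∫ u : ℝ, f₂ u|
      ≤ C * B ^ (η ^ 2) * (d : ℝ) ^ ((1 : ℝ) / 2 + ε) := by
  intro η hη hη1 ε hε c hc CJ hCJ
  obtain ⟨M, hM, hlog⟩ := log_rpow_le_mul_rpow hη hc
  set J := ⌈4 / η⌉₊
  have hJ : 4 ≤ η * (J + 1 : ℕ) := by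
    have : 4 / η ≤ J := Nat.le_ceil _
    rw [div_le_iff₀ hη] at this
    push_cast
    linarith
  refine ⟨4 * (CJ (J + 1) * M ^ (J + 1)), by have := hCJ (J + 1); positivity, ?_⟩
  intro B hB δ hδ hδ1 f hf hsupp hder a b _ _ hab d hd0 hd hdB
  have hB0 : 0 < B := by linarith
  have hB1 : 1 ≤ B := by linarith
  have hL : 0 < Real.log B := Real.log_pos (by linarith)
  have hδ0 : 0 < δ := (Real.rpow_pos_of_pos hL _).trans_le hδ
  have hd1 : (1 : ℝ) ≤ d := by exact_mod_cast hd0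
  have hdB' : (d : ℝ) ≤ B := hdB.trans (by
    simpa using Real.rpow_le_rpow_of_exponent_le hB1 (by linarith : 1 - η ≤ 1))
  have hCpos := hCJ (J + 1)
  have hstep : (d / B) * δ⁻¹ ≤ M * B ^ (-(η / 2)) := by
    have h1 : (d : ℝ) / B ≤ B ^ (-η) := by
      rw [div_le_iff₀ hB0]
      refine hdB.trans_eq ?_
      rw [← Real.rpow_add_one hB0.ne']
      ring_nf
    have h2 : δ⁻¹ ≤ M * B ^ (η / 2) := by
      refine le_trans ?_ (hlog B hB1)
      rw [inv_le_comm₀ hδ0 (by positivity), ← Real.rpow_neg hL.le]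
      exact hδ
    calc (d / B) * δ⁻¹ ≤ B ^ (-η) * (M * B ^ (η / 2)) := by gcongr
      _ = M * (B ^ (-η) * B ^ (η / 2)) := by ring
      _ = M * B ^ (-(η / 2)) := by
        rw [← Real.rpow_add hB0]
        ring_nf
  have hpow : (B ^ (-(η / 2))) ^ (J + 1) ≤ (B ^ 2)⁻¹ := by
    rw [← Real.rpow_natCast, ← Real.rpow_mul hB0.le, ← Real.rpow_natCast B 2,
      ← Real.rpow_neg hB0.le]
    refine Real.rpow_le_rpow_of_exponent_le hB1 ?_
    push_cast at hJ ⊢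
    linarith
  have hceil : (⌈3 * B⌉₊ : ℝ) ≤ 4 * B := by
    linarith [Nat.ceil_lt_add_one (by positivity : 0 ≤ 3 * B)]
  have hmain := abs_tsum_rhoDensity'_sub_le hab hd hdB' hf
    (hsupp.trans (Set.Icc_subset_Icc_right (by linarith))) J (hder (J + 1))
  have hconst : (d : ℝ) * (⌈3 * B⌉₊ * ((d / B) ^ (J + 1) *
      (CJ (J + 1) * δ ^ (-((J + 1 : ℕ) : ℝ))))) ≤ 4 * (CJ (J + 1) * M ^ (J + 1)) := by
    rw [Real.rpow_neg hδ0.le, Real.rpow_natCast]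
    calc (d : ℝ) * (⌈3 * B⌉₊ * ((d / B) ^ (J + 1) * (CJ (J + 1) * (δ ^ (J + 1))⁻¹)))
        = (d : ℝ) * (⌈3 * B⌉₊ * (CJ (J + 1) * ((d / B) * δ⁻¹) ^ (J + 1))) := by
          rw [mul_pow, inv_pow]
          ring
      _ ≤ B * (4 * B * (CJ (J + 1) * (M * B ^ (-(η / 2))) ^ (J + 1))) := by gcongr
      _ = 4 * (CJ (J + 1) * M ^ (J + 1)) * (B ^ 2 * (B ^ (-(η / 2))) ^ (J + 1)) := by
          rw [mul_pow]
          ring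
      _ ≤ 4 * (CJ (J + 1) * M ^ (J + 1)) * (B ^ 2 * (B ^ 2)⁻¹) := by gcongr
      _ = 4 * (CJ (J + 1) * M ^ (J + 1)) := by
          rw [mul_inv_cancel₀ (by positivity), mul_one]
  refine (hmain.trans hconst).trans ?_
  rw [mul_assoc]
  exact le_mul_of_one_le_right (by positivity) (one_le_mul_of_one_le_of_one_le
    (Real.one_le_rpow hB1 (by positivity)) (Real.one_le_rpow hd1 (by positivity)))
end

section
/- (Nonvanishing of the cross-product discriminant for distinct points) Let h be a positive integer and let (𝔞₁, 𝔟₁, 𝔠₁) and (𝔞₂, 𝔟₂, 𝔠₂) be two distinct triples of integers satisfying 𝔟_j² + h = 𝔞_j 𝔠_j and 𝔞_j > 0, 𝔠_j > 0 for j = 1, 2. Define the cross product (u₁, u₂, u₃) := (𝔟₁𝔠₂ − 𝔠₁𝔟₂, 𝔠₁𝔞₂ − 𝔞₁𝔠₂, 𝔞₁𝔟₂ − 𝔟₁𝔞₂). Then (u₁, u₂, u₃) ≠ (0,0,0) and u₂² − 4u₁u₃ ≠ 0. -/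
/-- The mixed invariant of two positive definite forms of determinant `h` exceeds `2h` by a
positive multiple of a sum of squares. -/
theorem mul_mixed_sub_two_mul_eq {R : Type*} [CommRing R] {h a₁ b₁ c₁ a₂ b₂ c₂ : R}
    (h₁ : b₁ ^ 2 + h = a₁ * c₁) (h₂ : b₂ ^ 2 + h = a₂ * c₂) :
    a₁ * a₂ * (a₁ * c₂ + c₁ * a₂ - 2 * b₁ * b₂ - 2 * h) =
      (a₁ * b₂ - b₁ * a₂) ^ 2 + h * (a₁ - a₂) ^ 2 := by
  linear_combination -a₁ ^ 2 * h₂ - a₂ ^ 2 * h₁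

/-- The cross-product discriminant of two forms of determinant `h` factors. -/
theorem crossProduct_discrim_eq {R : Type*} [CommRing R] {h a₁ b₁ c₁ a₂ b₂ c₂ : R}
    (h₁ : b₁ ^ 2 + h = a₁ * c₁) (h₂ : b₂ ^ 2 + h = a₂ * c₂) :
    (c₁ * a₂ - a₁ * c₂) ^ 2 - 4 * (b₁ * c₂ - c₁ * b₂) * (a₁ * b₂ - b₁ * a₂) =
      (a₁ * c₂ + c₁ * a₂ - 2 * b₁ * b₂ - 2 * h) *
        (a₁ * c₂ + c₁ * a₂ - 2 * b₁ * b₂ + 2 * h) := by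
  linear_combination 4 * (a₂ * c₂ - b₂ ^ 2) * h₁ + 4 * h * h₂


/-- **Nonvanishing of the cross-product discriminant for distinct points.**
If `(𝔞₁,𝔟₁,𝔠₁) ≠ (𝔞₂,𝔟₂,𝔠₂)` are integer triples with `𝔟ⱼ² + h = 𝔞ⱼ𝔠ⱼ`, `𝔞ⱼ, 𝔠ⱼ > 0`,
then the cross product `(u₁,u₂,u₃)` is nonzero and `u₂² − 4u₁u₃ ≠ 0`. -/
theorem stmt15 (h : ℤ) (hh : 0 < h) (a₁ b₁ c₁ a₂ b₂ c₂ : ℤ)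
    (h₁ : b₁ ^ 2 + h = a₁ * c₁) (h₂ : b₂ ^ 2 + h = a₂ * c₂)
    (ha₁ : 0 < a₁) (hc₁ : 0 < c₁) (ha₂ : 0 < a₂) (hc₂ : 0 < c₂)
    (hne : (a₁, b₁, c₁) ≠ (a₂, b₂, c₂)) :
    (b₁ * c₂ - c₁ * b₂, c₁ * a₂ - a₁ * c₂, a₁ * b₂ - b₁ * a₂) ≠ ((0 : ℤ), (0 : ℤ), (0 : ℤ)) ∧
    (c₁ * a₂ - a₁ * c₂) ^ 2 - 4 * (b₁ * c₂ - c₁ * b₂) * (a₁ * b₂ - b₁ * a₂) ≠ 0 := by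
  have key := mul_mixed_sub_two_mul_eq h₁ h₂
  have hpos : 0 < a₁ * c₂ + c₁ * a₂ - 2 * b₁ * b₂ - 2 * h := by
    refine pos_of_mul_pos_right (a := a₁ * a₂) ?_ (mul_pos ha₁ ha₂).le
    rw [key]
    by_cases ha : a₁ = a₂
    · subst ha
      have hb : b₁ ≠ b₂ := by
        rintro rfl
        exact hne (by rw [mul_left_cancel₀ ha₁.ne' (h₁.symm.trans h₂)])
      have hu : a₁ * b₂ - b₁ * a₁ ≠ 0 := by
        rw [mul_comm b₁, ← mul_sub]
        exact mul_ne_zero ha₁.ne' (sub_ne_zero.mpr hb.symm)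
      positivity
    · have := sub_ne_zero.mpr ha
      positivity
  have hdisc : (c₁ * a₂ - a₁ * c₂) ^ 2 - 4 * (b₁ * c₂ - c₁ * b₂) * (a₁ * b₂ - b₁ * a₂) ≠ 0 := by
    rw [crossProduct_discrim_eq h₁ h₂]
    exact (mul_pos hpos (by linarith)).ne'
  refine ⟨fun hu => hdisc ?_, hdisc⟩
  simp only [Prod.mk.injEq] at hu
  simp [hu.1, hu.2.1]
end

section
/- (Average of the local density over shifts) Let d be a squarefree positive integer and let a, b be coprime positive integers. Then Σ_{y=0}^{d−1} #{x ∈ ℤ/dℤ : a x² + b y³ ≡ 0 (mod d)} = d. -/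
/-- Over a field, the curve `a x² + b y³ = 0` with `a`, `b` not both zero has as many points as the
affine line. -/
theorem card_cuspidal_cubic_field {K : Type*} [Field K] (a b : K) (hab : a ≠ 0 ∨ b ≠ 0) :
    Nat.card {p : K × K // a * p.1 ^ 2 + b * p.2 ^ 3 = 0} = Nat.card K := by
  by_cases ha : a = 0
  · have hb : b ≠ 0 := by simpa [ha] using hab
    refine Nat.card_congr
      { toFun := fun p => p.1.1
        invFun := fun x => ⟨(x, 0), by simp [ha]⟩
        left_inv := ?_
        right_inv := fun x => rfl }
    rintro ⟨⟨x, y⟩, h⟩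
    have hy : y = 0 := by simpa [ha, hb] using h
    simp [hy]
  by_cases hb : b = 0
  · refine Nat.card_congr
      { toFun := fun p => p.1.2
        invFun := fun y => ⟨(0, y), by simp [hb]⟩
        left_inv := ?_
        right_inv := fun y => rfl }
    rintro ⟨⟨x, y⟩, h⟩
    have hx : x = 0 := by simpa [ha, hb] using h
    simp [hx]
  refine Nat.card_congr
    { toFun := fun p => p.1.1 / p.1.2
      invFun := fun t => ⟨(t * (-(a * t ^ 2) / b), -(a * t ^ 2) / b), by field_simp; ring⟩
      left_inv := ?_
      right_inv := ?_ }
  · rintro ⟨⟨x, y⟩, h⟩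
    simp only at h
    by_cases hy : y = 0
    · have hx : x = 0 := by simpa [ha, hy] using h
      simp [hx, hy]
    · have key : -(a * (x / y) ^ 2) / b = y := by
        field_simp
        linear_combination -h
      simp only [key, Subtype.mk.injEq, Prod.mk.injEq, and_true]
      field_simp
  · intro t
    by_cases ht : t = 0
    · simp [ht]
    · simp only
      field_simp

/-- The number of solutions of `a x² + b y³ = 0` is multiplicative over coprime moduli. -/
theorem card_cuspidal_cubic_mul (a b : ℕ) {m n : ℕ} (hmn : m.Coprime n) :
    Nat.card {p : ZMod (m * n) × ZMod (m * n) // (a : ZMod (m * n)) * p.1 ^ 2 + b * p.2 ^ 3 = 0} =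
      Nat.card {p : ZMod m × ZMod m // (a : ZMod m) * p.1 ^ 2 + b * p.2 ^ 3 = 0} *
        Nat.card {p : ZMod n × ZMod n // (a : ZMod n) * p.1 ^ 2 + b * p.2 ^ 3 = 0} := by
  rw [← Nat.card_prod]
  let e := ZMod.chineseRemainder hmn
  let f := (e.toEquiv.prodCongr e.toEquiv).trans (Equiv.prodProdProdComm _ _ _ _)
  refine Nat.card_congr ((f.subtypeEquiv fun p => ?_).trans Equiv.subtypeProdEquivProd)
  rw [← map_eq_zero_iff e e.injective]
  simp [f, Prod.ext_iff]

theorem card_cuspidal_cubic_zmod {a b d : ℕ} (hd : Squarefree d) (hab : a.Coprime b) :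
    Nat.card {p : ZMod d × ZMod d // (a : ZMod d) * p.1 ^ 2 + b * p.2 ^ 3 = 0} = d := by
  induction d using Nat.recOnPosPrimePosCoprime with
  | zero => simp at hd
  | one =>
    have : Unique {p : ZMod 1 × ZMod 1 // (a : ZMod 1) * p.1 ^ 2 + b * p.2 ^ 3 = 0} :=
      ⟨⟨0, Subsingleton.elim _ _⟩, fun _ => Subsingleton.elim _ _⟩
    exact Nat.card_unique
  | prime_pow p n hp hn =>
    obtain rfl : n = 1 := ((Nat.squarefree_pow_iff hp.ne_one hn.ne').1 hd).2
    rw [pow_one]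
    have : Fact p.Prime := ⟨hp⟩
    rw [card_cuspidal_cubic_field, Nat.card_zmod]
    by_contra! h
    simp only [ZMod.natCast_eq_zero_iff] at h
    exact Nat.not_coprime_of_dvd_of_dvd hp.one_lt h.1 h.2 hab
  | coprime m n _ _ hmn ihm ihn =>
    rw [card_cuspidal_cubic_mul a b hmn, ihm hd.of_mul_left, ihn hd.of_mul_right]

/-- **Average of the local density over shifts.**
For `d` squarefree and `a, b` coprime positive integers,
`Σ_{y=0}^{d−1} #{x ∈ ℤ/dℤ : a x² + b y³ ≡ 0 (mod d)} = d`. -/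
theorem stmt16 (d a b : ℕ) (hd : 0 < d) (hsq : Squarefree d) (ha : 0 < a) (hb : 0 < b)
    (hab : Nat.Coprime a b) :
    ∑ y ∈ Finset.range d,
      Nat.card {x : ZMod d // (a : ZMod d) * x ^ 2 + (b : ZMod d) * (y : ZMod d) ^ 3 = 0} = d := by
  have : NeZero d := ⟨hd.ne'⟩
  calc
    _ = ∑ y : ZMod d, Nat.card {x : ZMod d // (a : ZMod d) * x ^ 2 + b * y ^ 3 = 0} := by
      refine Finset.sum_bij (fun y _ => (y : ZMod d)) (fun _ _ => Finset.mem_univ _) ?_ ?_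
        (fun _ _ => rfl)
      · intro y hy z hz h
        rw [ZMod.natCast_eq_natCast_iff'] at h
        rwa [Nat.mod_eq_of_lt (Finset.mem_range.1 hy), Nat.mod_eq_of_lt (Finset.mem_range.1 hz)]
          at h
      · exact fun y _ => ⟨y.val, Finset.mem_range.2 y.val_lt, ZMod.natCast_zmod_val y⟩
    _ = Nat.card (Σ y : ZMod d, {x : ZMod d // (a : ZMod d) * x ^ 2 + b * y ^ 3 = 0}) :=
      Nat.card_sigma.symm
    _ = Nat.card {p : ZMod d × ZMod d // (a : ZMod d) * p.1 ^ 2 + b * p.2 ^ 3 = 0} :=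
      Nat.card_congr
        { toFun := fun q => ⟨(q.2.1, q.1), q.2.2⟩
          invFun := fun p => ⟨p.1.2, p.1.1, p.2⟩
          left_inv := fun _ => rfl
          right_inv := fun _ => rfl }
    _ = d := card_cuspidal_cubic_zmod hsq hab
end

section
/- (Alignment of pairs under unipotent translations) Let a, h be positive integers with gcd(a,h) = 1, and let s, n₁, n₂ be positive integers with gcd(n₁,n₂) = 1 and gcd(a, s n₁ n₂) = 1. Let 𝔤₁ ∈ S_{a,h}(s n₁) and 𝔤₂ ∈ S_{a,h}(s n₂), written 𝔤_j = (𝔞 𝔟_j; 𝔟_j 𝔠_j) with equal top-left entries 𝔞, and suppose 𝔟₁ ≡ 𝔟₂ (mod s𝔞). Then there exist integers x₁, x₂ with a s n₁ ∣ x₁ and a s n₂ ∣ x₂ such that n[x₁]ᵗ ⋄ 𝔤₁ = n[x₂]ᵗ ⋄ 𝔤₂. -/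
open Matrix

/-- The top-left entry of a matrix in `S_{a,h}(d)` is coprime to `a` when `gcd(a,h) = 1`. -/
theorem isCoprime_top_of_mem_Sah {a h d : ℕ} (ha : 0 < a) (hah : Nat.Coprime a h)
    {g : Matrix (Fin 2) (Fin 2) ℤ} (hg : g ∈ Sah a h d) : IsCoprime (a : ℤ) (g 0 0) := by
  obtain ⟨-, hdet, -, -, ⟨c, hc⟩, b, hb⟩ := hg
  have hdiv : g 0 0 * (d * c) - a * b ^ 2 = h := by
    have ha' : (a : ℤ) ≠ 0 := by exact_mod_cast ha.ne'
    apply mul_left_cancel₀ ha'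
    rw [hc, hb] at hdet
    linear_combination hdet
  obtain ⟨u, v, huv⟩ := Nat.isCoprime_iff_coprime.mpr hah
  exact ⟨u - v * b ^ 2, v * (d * c), by linear_combination huv + v * hdiv⟩

/-- Two symmetric matrices with the same nonzero top-left entry and the same determinant agree
after unipotent translations that match their off-diagonal entries. -/
theorem ltu_conj_eq_of_offDiag_eq {g₁ g₂ : Matrix (Fin 2) (Fin 2) ℤ}
    (hsymm₁ : g₁ 0 1 = g₁ 1 0) (hsymm₂ : g₂ 0 1 = g₂ 1 0)
    (htop : g₁ 0 0 = g₂ 0 0) (hne : g₁ 0 0 ≠ 0)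
    (hdet : g₁ 0 0 * g₁ 1 1 - g₁ 0 1 ^ 2 = g₂ 0 0 * g₂ 1 1 - g₂ 0 1 ^ 2) {x₁ x₂ : ℤ}
    (hoff : g₁ 0 1 + x₁ * g₁ 0 0 = g₂ 0 1 + x₂ * g₂ 0 0) :
    ltu x₁ * g₁ * (ltu x₁)ᵀ = ltu x₂ * g₂ * (ltu x₂)ᵀ := by
  rw [← htop] at hdet hoff
  have hbot : g₁ 1 1 + 2 * x₁ * g₁ 0 1 + x₁ ^ 2 * g₁ 0 0 =
      g₂ 1 1 + 2 * x₂ * g₂ 0 1 + x₂ ^ 2 * g₁ 0 0 := by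
    apply mul_left_cancel₀ hne
    linear_combination hdet +
      (g₁ 0 1 + x₁ * g₁ 0 0 + g₂ 0 1 + x₂ * g₁ 0 0) * hoff
  ext i j
  fin_cases i <;> fin_cases j <;>
    simp [ltu, Matrix.mul_apply, Matrix.vecMul, dotProduct, Fin.sum_univ_two,
      ← hsymm₁, ← hsymm₂, ← htop]
  · linear_combination hoff
  · linear_combination hoff
  · linear_combination hbot

/-- **Alignment of pairs under unipotent translations.** If `𝔤₁ ∈ S_{a,h}(sn₁)` and
`𝔤₂ ∈ S_{a,h}(sn₂)` have the same top-left entry `𝔞` and `𝔟₁ ≡ 𝔟₂ (mod s𝔞)`, with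
`gcd(a,h) = gcd(n₁,n₂) = 1` and `gcd(a, sn₁n₂) = 1`, then there are integers `x₁, x₂`
with `asn₁ ∣ x₁`, `asn₂ ∣ x₂` and `n[x₁]ᵗ ⋄ 𝔤₁ = n[x₂]ᵗ ⋄ 𝔤₂`. -/
theorem stmt17 (a h s n₁ n₂ : ℕ) (ha : 0 < a) (hh : 0 < h) (hs : 0 < s)
    (hn₁ : 0 < n₁) (hn₂ : 0 < n₂)
    (hah : Nat.Coprime a h) (hn : Nat.Coprime n₁ n₂) (has : Nat.Coprime a (s * n₁ * n₂))
    (g₁ g₂ : Matrix (Fin 2) (Fin 2) ℤ)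
    (hg₁ : g₁ ∈ Sah a h (s * n₁)) (hg₂ : g₂ ∈ Sah a h (s * n₂))
    (htop : g₁ 0 0 = g₂ 0 0)
    (hb : ((s : ℤ) * g₁ 0 0) ∣ (g₁ 0 1 - g₂ 0 1)) :
    ∃ x₁ x₂ : ℤ, ((a : ℤ) * s * n₁) ∣ x₁ ∧ ((a : ℤ) * s * n₂) ∣ x₂ ∧
      ltu x₁ * g₁ * (ltu x₁)ᵀ = ltu x₂ * g₂ * (ltu x₂)ᵀ := by
  have hcop := isCoprime_top_of_mem_Sah ha hah hg₁
  obtain ⟨hsymm₁, hdet₁, hpos, -, -, ha₁⟩ := hg₁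
  obtain ⟨hsymm₂, hdet₂, -, -, -, ha₂⟩ := hg₂
  obtain ⟨k, hk⟩ := hb
  have hcs : IsCoprime (a : ℤ) s :=
    Nat.isCoprime_iff_coprime.mpr has.coprime_mul_right_right.coprime_mul_right_right
  obtain ⟨m, rfl⟩ : (a : ℤ) ∣ k :=
    (hcs.mul_right hcop).dvd_of_dvd_mul_left (hk ▸ dvd_sub ha₁ ha₂)
  obtain ⟨u, v, huv⟩ := Nat.isCoprime_iff_coprime.mpr hn
  refine ⟨a * s * n₁ * (-(u * m)), a * s * n₂ * (v * m), dvd_mul_right _ _, dvd_mul_right _ _,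
    ltu_conj_eq_of_offDiag_eq hsymm₁ hsymm₂ htop hpos.ne' (hdet₁.trans hdet₂.symm) ?_⟩
  rw [← htop]
  linear_combination hk - a * s * m * g₁ 0 0 * huv
end
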